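/- Let a > b > 0 and a < r < a²/b. Then the area of the set {x ∈ ℝ² : (sphere(x,r) ∩ C(a,b)) has cardinality 2} equals 2πr² + 2πab − 2F(β), where F(φ) = 2r²φ + 2ab·arctan((b/a)tanφ) − 4ra·E(φ,ε) + raε² sin(2φ)/√(1−ε² sin²φ) and β = arctan( a√(r² − a²) / √(a⁴ − r²b²) ). -/

import Mathlib

open Real MeasureTheory Set Metric

noncomputable section

/-- The Euclidean plane. -/
abbrev E2 := EuclideanSpace ℝ (Fin 2)

/-- Closed elliptical region with semi-axes `a`, `b`. -/
def Kset (a b : ℝ) : Set E2 := {x | (x 0)^2 / a^2 + (x 1)^2 / b^2 ≤ 1}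

/-- The ellipse with semi-axes `a`, `b`. -/
def Cset (a b : ℝ) : Set E2 := {x | (x 0)^2 / a^2 + (x 1)^2 / b^2 = 1}

/-- Incomplete elliptic integral of the second kind `E(φ, ε)`. -/
def Einc (ε φ : ℝ) : ℝ := ∫ θ in (0:ℝ)..φ, Real.sqrt (1 - ε^2 * Real.sin θ^2)

/-- Complete elliptic integral of the second kind `E(ε)`. -/
def Ecomp (ε : ℝ) : ℝ := Einc ε (π/2)

/-- Eccentricity of the ellipse with semi-axes `a ≥ b`. -/
def ecc (a b : ℝ) : ℝ := Real.sqrt (a^2 - b^2) / a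
/-- The antiderivative `F(φ)` from the paper's Lemma 1. -/
def Ffun (a b r φ : ℝ) : ℝ :=
  2*r^2*φ + 2*a*b*Real.arctan ((b/a)*Real.tan φ) - 4*r*a*Einc (ecc a b) φ
    + r*a*(ecc a b)^2 * Real.sin (2*φ) / Real.sqrt (1 - (ecc a b)^2 * Real.sin φ^2)
/-- The angle `β` from Case 4 of the paper's Lemma 1. -/
def betaAng (a b r : ℝ) : ℝ :=
  Real.arctan (a * Real.sqrt (r^2 - a^2) / Real.sqrt (a^4 - r^2*b^2))

/-- The function whose level set `a² - b²` consists of the feet of the normals through a point. -/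
def normalEqn (α β x : ℝ) : ℝ := α / cos x + β / sin x

lemma sin_pos_of_mem_quadrant {x : ℝ} (hx : x ∈ Ioo 0 (π / 2)) : 0 < sin x :=
  sin_pos_of_pos_of_lt_pi hx.1 (by linarith [hx.2, pi_pos])

lemma cos_pos_of_mem_quadrant {x : ℝ} (hx : x ∈ Ioo 0 (π / 2)) : 0 < cos x :=
  cos_pos_of_mem_Ioo ⟨by linarith [hx.1, pi_pos], hx.2⟩

lemma sin_lt_sin_of_mem_quadrant {x y : ℝ} (hx : x ∈ Ioo 0 (π / 2)) (hy : y ∈ Ioo 0 (π / 2))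
    (hxy : x < y) : sin x < sin y :=
  sin_lt_sin_of_lt_of_le_pi_div_two (by linarith [hx.1, pi_pos]) hy.2.le hxy

lemma cos_lt_cos_of_mem_quadrant {x y : ℝ} (hx : x ∈ Ioo 0 (π / 2)) (hy : y ∈ Ioo 0 (π / 2))
    (hxy : x < y) : cos y < cos x :=
  cos_lt_cos_of_nonneg_of_le_pi_div_two hx.1.le hy.2.le hxy

lemma normalEqn_strictMonoOn {P Q : ℝ} (hP : 0 < P) (hQ : 0 < Q) :
    StrictMonoOn (normalEqn P (-Q)) (Ioo 0 (π / 2)) := by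
  intro x hx y hy hxy
  have h1 := sin_lt_sin_of_mem_quadrant hx hy hxy
  have h2 := cos_lt_cos_of_mem_quadrant hx hy hxy
  have h3 : P / cos x < P / cos y :=
    div_lt_div_of_pos_left hP (cos_pos_of_mem_quadrant hy) h2
  have h4 : Q / sin y < Q / sin x :=
    div_lt_div_of_pos_left hQ (sin_pos_of_mem_quadrant hx) h1
  simp only [normalEqn, neg_div]
  linarith

/-- The sign of this expression is the sign of the derivative of `normalEqn P Q`. -/
def cubicSlope (P Q x : ℝ) : ℝ := P * sin x ^ 3 - Q * cos x ^ 3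

lemma cubicSlope_strictMonoOn {P Q : ℝ} (hP : 0 < P) (hQ : 0 < Q) :
    StrictMonoOn (cubicSlope P Q) (Ioo 0 (π / 2)) := by
  intro x hx y hy hxy
  have h1 := pow_lt_pow_left₀ (sin_lt_sin_of_mem_quadrant hx hy hxy)
    (sin_pos_of_mem_quadrant hx).le three_ne_zero
  have h2 := pow_lt_pow_left₀ (cos_lt_cos_of_mem_quadrant hx hy hxy)
    (cos_pos_of_mem_quadrant hy).le three_ne_zero
  simp only [cubicSlope]
  nlinarith

lemma hasDerivAt_normalEqn {P Q x : ℝ} (hx : x ∈ Ioo 0 (π / 2)) :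
    HasDerivAt (normalEqn P Q) (cubicSlope P Q x / (sin x ^ 2 * cos x ^ 2)) x := by
  have hs := (sin_pos_of_mem_quadrant hx).ne'
  have hc := (cos_pos_of_mem_quadrant hx).ne'
  convert! ((hasDerivAt_const x P).div (hasDerivAt_cos x) hc).add
    ((hasDerivAt_const x Q).div (hasDerivAt_sin x) hs) using 1
  simp only [cubicSlope]
  field_simp
  ring

lemma normalEqn_lt_of_cubicSlope_nonneg {P Q x y : ℝ} (hP : 0 < P) (hQ : 0 < Q)
    (hx : x ∈ Ioo 0 (π / 2)) (hy : y ∈ Ioo 0 (π / 2)) (hxy : x < y) (h : 0 ≤ cubicSlope P Q x) :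
    normalEqn P Q x < normalEqn P Q y := by
  have hmem : ∀ z ∈ Icc x y, z ∈ Ioo 0 (π / 2) := fun z hz =>
    ⟨hx.1.trans_le hz.1, hz.2.trans_lt hy.2⟩
  refine strictMonoOn_of_deriv_pos (convex_Icc x y)
    (fun z hz => (hasDerivAt_normalEqn (hmem z hz)).continuousAt.continuousWithinAt) ?_
    (left_mem_Icc.2 hxy.le) (right_mem_Icc.2 hxy.le) hxy
  intro z hz
  rw [interior_Icc] at hz
  have hz' := hmem z (Ioo_subset_Icc_self hz)
  rw [(hasDerivAt_normalEqn hz').deriv]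
  have := cubicSlope_strictMonoOn hP hQ hx hz' hz.1
  have := sin_pos_of_mem_quadrant hz'
  have := cos_pos_of_mem_quadrant hz'
  exact div_pos (by linarith) (by positivity)

lemma normalEqn_lt_of_cubicSlope_nonpos {P Q x y : ℝ} (hP : 0 < P) (hQ : 0 < Q)
    (hx : x ∈ Ioo 0 (π / 2)) (hy : y ∈ Ioo 0 (π / 2)) (hxy : x < y) (h : cubicSlope P Q y ≤ 0) :
    normalEqn P Q y < normalEqn P Q x := by
  have hmem : ∀ z ∈ Icc x y, z ∈ Ioo 0 (π / 2) := fun z hz =>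
    ⟨hx.1.trans_le hz.1, hz.2.trans_lt hy.2⟩
  refine strictAntiOn_of_deriv_neg (convex_Icc x y)
    (fun z hz => (hasDerivAt_normalEqn (hmem z hz)).continuousAt.continuousWithinAt) ?_
    (left_mem_Icc.2 hxy.le) (right_mem_Icc.2 hxy.le) hxy
  intro z hz
  rw [interior_Icc] at hz
  have hz' := hmem z (Ioo_subset_Icc_self hz)
  rw [(hasDerivAt_normalEqn hz').deriv]
  have := cubicSlope_strictMonoOn hP hQ hz' hy hz.2
  have := sin_pos_of_mem_quadrant hz'
  have := cos_pos_of_mem_quadrant hz'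
  exact div_neg_of_neg_of_pos (by linarith) (by positivity)

lemma exists_cubicSlope_eq_zero {P Q : ℝ} (hP : 0 < P) (hQ : 0 < Q) :
    ∃ x ∈ Ioo 0 (π / 2), cubicSlope P Q x = 0 := by
  have hc : ContinuousOn (cubicSlope P Q) (Icc 0 (π / 2)) := by
    unfold cubicSlope; fun_prop
  have h0 : (0 : ℝ) ∈ Ioo (cubicSlope P Q 0) (cubicSlope P Q (π / 2)) := by
    simp [cubicSlope, hP, hQ]
  obtain ⟨x, hx, h⟩ := intermediate_value_Ioo (by positivity) hc h0
  exact ⟨x, hx, h⟩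

/-- Half of the derivative of the squared distance from a point to the points of an ellipse. -/
def halfSlope (P Q m x : ℝ) : ℝ := P * sin x - Q * cos x - m * sin x * cos x

lemma continuous_halfSlope (P Q m : ℝ) : Continuous (halfSlope P Q m) := by
  unfold halfSlope; fun_prop

lemma halfSlope_eq {P Q m x : ℝ} (hx : x ∈ Ioo 0 (π / 2)) :
    halfSlope P Q m x = sin x * cos x * (normalEqn P (-Q) x - m) := by
  have hs := (sin_pos_of_mem_quadrant hx).ne'
  have hc := (cos_pos_of_mem_quadrant hx).ne'
  simp only [halfSlope, normalEqn]
  field_simp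
  ring

lemma halfSlope_neg_eq {P Q m x : ℝ} (hx : x ∈ Ioo 0 (π / 2)) :
    halfSlope P Q m (-x) = sin x * cos x * (m - normalEqn P Q x) := by
  have hs := (sin_pos_of_mem_quadrant hx).ne'
  have hc := (cos_pos_of_mem_quadrant hx).ne'
  simp only [halfSlope, normalEqn, sin_neg, cos_neg]
  field_simp
  ring

lemma halfSlope_sub_pi_eq {P Q m x : ℝ} (hx : x ∈ Ioo 0 (π / 2)) :
    halfSlope P Q m (x - π) = sin x * cos x * (- normalEqn P (-Q) x - m) := by
  have hs := (sin_pos_of_mem_quadrant hx).ne'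
  have hc := (cos_pos_of_mem_quadrant hx).ne'
  simp only [halfSlope, normalEqn, sin_sub_pi, cos_sub_pi]
  field_simp
  ring

lemma exists_normalEqn_eq {P Q : ℝ} (hP : 0 < P) (hQ : 0 < Q) (m : ℝ) :
    ∃ x ∈ Ioo 0 (π / 2), normalEqn P (-Q) x = m := by
  have h0 : (0 : ℝ) ∈ Ioo (halfSlope P Q m 0) (halfSlope P Q m (π / 2)) := by
    simp [halfSlope, hP, hQ]
  obtain ⟨x, hx, h⟩ := intermediate_value_Ioo (by positivity)
    (continuous_halfSlope P Q m).continuousOn h0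
  refine ⟨x, hx, ?_⟩
  rw [halfSlope_eq hx] at h
  have := mul_pos (sin_pos_of_mem_quadrant hx) (cos_pos_of_mem_quadrant hx)
  have := (mul_eq_zero.1 h).resolve_left this.ne'
  linarith

lemma exists_normalEqn_eq_eq {P Q m x : ℝ} (hP : 0 < P) (hQ : 0 < Q) (hx : x ∈ Ioo 0 (π / 2))
    (hm : normalEqn P Q x < m) :
    (∃ y ∈ Ioo 0 x, normalEqn P Q y = m) ∧ ∃ y ∈ Ioo x (π / 2), normalEqn P Q y = m := by
  have hc : Continuous fun y => halfSlope P Q m (-y) :=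
    (continuous_halfSlope P Q m).comp continuous_neg
  have hpos : 0 < halfSlope P Q m (-x) := by
    rw [halfSlope_neg_eq hx]
    exact mul_pos (mul_pos (sin_pos_of_mem_quadrant hx) (cos_pos_of_mem_quadrant hx))
      (by linarith)
  have key : ∀ y ∈ Ioo 0 (π / 2), halfSlope P Q m (-y) = 0 → normalEqn P Q y = m := by
    intro y hy h
    rw [halfSlope_neg_eq hy] at h
    have := mul_pos (sin_pos_of_mem_quadrant hy) (cos_pos_of_mem_quadrant hy)
    have := (mul_eq_zero.1 h).resolve_left this.ne'
    linarith
  constructor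
  · obtain ⟨y, hy, h⟩ := intermediate_value_Ioo hx.1.le hc.continuousOn
      (show (0 : ℝ) ∈ Ioo _ _ from ⟨by simp [halfSlope, hQ], hpos⟩)
    exact ⟨y, hy, key y ⟨hy.1, hy.2.trans hx.2⟩ h⟩
  · obtain ⟨y, hy, h⟩ := intermediate_value_Ioo' hx.2.le hc.continuousOn
      (show (0 : ℝ) ∈ Ioo _ _ from ⟨by simp [halfSlope, hP], hpos⟩)
    exact ⟨y, hy, key y ⟨hx.1.trans hy.1, hy.2⟩ h⟩

lemma existsUnique_eq_of_strictAntiOn {f : ℝ → ℝ} {x y v : ℝ} (hf : Continuous f) (hxy : x ≤ y)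
    (h : StrictAntiOn f (Icc x y)) (hx : v < f x) (hy : f y < v) : ∃! z, z ∈ Icc x y ∧ f z = v := by
  obtain ⟨z, hz, hzv⟩ := intermediate_value_Icc' hxy hf.continuousOn ⟨hy.le, hx.le⟩
  exact ⟨z, ⟨hz, hzv⟩, fun w hw => h.injOn hw.1 hz (hw.2.trans hzv.symm)⟩

lemma existsUnique_eq_of_strictMonoOn {f : ℝ → ℝ} {x y v : ℝ} (hf : Continuous f) (hxy : x ≤ y)
    (h : StrictMonoOn f (Icc x y)) (hx : f x < v) (hy : v < f y) : ∃! z, z ∈ Icc x y ∧ f z = v := by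
  obtain ⟨z, hz, hzv⟩ := intermediate_value_Icc hxy hf.continuousOn ⟨hx.le, hy.le⟩
  exact ⟨z, ⟨hz, hzv⟩, fun w hw => h.injOn hw.1 hz (hw.2.trans hzv.symm)⟩

lemma ncard_levelSet_eq_two {f : ℝ → ℝ} {x y z v : ℝ} (hxy : x ≤ y) (hyz : y ≤ z)
    (h1 : ∃! w, w ∈ Icc x y ∧ f w = v) (h2 : ∃! w, w ∈ Icc y z ∧ f w = v)
    (hy : f y ≠ v) (hz : f z ≠ v) : {w ∈ Ico x z | f w = v}.ncard = 2 := by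
  obtain ⟨u, ⟨hu, huv⟩, hu'⟩ := h1
  obtain ⟨w, ⟨hw, hwv⟩, hw'⟩ := h2
  have huy : u < y := lt_of_le_of_ne hu.2 (fun h => hy (h ▸ huv))
  have hwz : w < z := lt_of_le_of_ne hw.2 (fun h => hz (h ▸ hwv))
  refine ncard_eq_two.2 ⟨u, w, (huy.trans_le hw.1).ne, ?_⟩
  ext s
  simp only [mem_ofPred_eq, mem_insert_iff, mem_singleton_iff]
  constructor
  · rintro ⟨hs, hsv⟩
    rcases le_total s y with h | h
    · exact Or.inl (hu' s ⟨⟨hs.1, h⟩, hsv⟩)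
    · exact Or.inr (hw' s ⟨⟨h, hs.2.le⟩, hsv⟩)
  · rintro (rfl | rfl)
    · exact ⟨⟨hu.1, huy.trans_le hyz⟩, huv⟩
    · exact ⟨⟨hxy.trans hw.1, hwz⟩, hwv⟩

lemma ncard_ne_two_of_three {α : Type*} {s : Set α} {x y z : α} (hx : x ∈ s) (hy : y ∈ s)
    (hz : z ∈ s) (hxy : x ≠ y) (hyz : y ≠ z) (hxz : x ≠ z) : s.ncard ≠ 2 := by
  intro h
  obtain ⟨u, v, -, rfl⟩ := ncard_eq_two.1 h
  simp only [mem_insert_iff, mem_singleton_iff] at hx hy hz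
  grind

section LevelSet

variable {P Q m : ℝ} {f : ℝ → ℝ}

lemma strictMonoOn_of_halfSlope_pos (hf : ∀ x, HasDerivAt f (2 * halfSlope P Q m x) x) {x y : ℝ}
    (h : ∀ z ∈ Ioo x y, 0 < halfSlope P Q m z) : StrictMonoOn f (Icc x y) := by
  refine strictMonoOn_of_deriv_pos (convex_Icc x y)
    (fun z _ => (hf z).continuousAt.continuousWithinAt) fun z hz => ?_
  rw [interior_Icc] at hz
  rw [(hf z).deriv]
  linarith [h z hz]

lemma strictAntiOn_of_halfSlope_neg (hf : ∀ x, HasDerivAt f (2 * halfSlope P Q m x) x) {x y : ℝ}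
    (h : ∀ z ∈ Ioo x y, halfSlope P Q m z < 0) : StrictAntiOn f (Icc x y) := by
  refine strictAntiOn_of_deriv_neg (convex_Icc x y)
    (fun z _ => (hf z).continuousAt.continuousWithinAt) fun z hz => ?_
  rw [interior_Icc] at hz
  rw [(hf z).deriv]
  linarith [h z hz]

lemma halfSlope_pos_of_mem_Ioo (hP : 0 < P) (hQ : 0 < Q) (hm : 0 < m) {x y z : ℝ}
    (hx : x ∈ Ioo 0 (π / 2)) (hy : y ∈ Ioo 0 (π / 2)) (hxm : normalEqn P (-Q) x = m)
    (hym : normalEqn P (-Q) y = -m) (hz : z ∈ Ioo x (y + π)) : 0 < halfSlope P Q m z := by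
  have hpi := pi_pos
  rcases lt_or_ge z (π / 2) with h | h
  · have hz' : z ∈ Ioo 0 (π / 2) := ⟨hx.1.trans hz.1, h⟩
    rw [halfSlope_eq hz']
    have := normalEqn_strictMonoOn hP hQ hx hz' hz.1
    exact mul_pos (mul_pos (sin_pos_of_mem_quadrant hz') (cos_pos_of_mem_quadrant hz'))
      (by linarith)
  rcases le_or_gt z π with h' | h'
  · have hs : 0 ≤ sin z := sin_nonneg_of_nonneg_of_le_pi (by linarith) h'
    have hc : cos z ≤ 0 := cos_nonpos_of_pi_div_two_le_of_le h (by linarith)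
    have h1 := sin_sq_add_cos_sq z
    simp only [halfSlope]
    have h2 : 0 ≤ -(m * sin z * cos z) := by
      have := mul_nonneg (mul_nonneg hm.le hs) (neg_nonneg.2 hc)
      linarith
    rcases hs.eq_or_lt with h0 | h0
    · have : cos z ≠ 0 := by intro h3; rw [← h0, h3] at h1; norm_num at h1
      have : 0 < Q * (-cos z) := mul_pos hQ (neg_pos.2 (lt_of_le_of_ne hc this))
      have := mul_nonneg hP.le hs
      linarith
    · have := mul_pos hP h0
      have : 0 ≤ Q * (-cos z) := mul_nonneg hQ.le (neg_nonneg.2 hc)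
      linarith
  · have hz' : z - π ∈ Ioo 0 (π / 2) := ⟨by linarith, by linarith [hz.2, hy.2]⟩
    have he : halfSlope P Q m z = halfSlope P Q m (z - π - π) := by
      simp only [halfSlope, sin_sub_pi, cos_sub_pi, neg_neg]
    rw [he, halfSlope_sub_pi_eq hz']
    have := normalEqn_strictMonoOn hP hQ hz' hy (by linarith [hz.2])
    exact mul_pos (mul_pos (sin_pos_of_mem_quadrant hz') (cos_pos_of_mem_quadrant hz'))
      (by linarith)

lemma halfSlope_neg_of_mem_Ioo_right (hP : 0 < P) (hQ : 0 < Q) {x y z : ℝ}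
    (hx : x ∈ Ioo 0 (π / 2)) (hy : y ∈ Ioo 0 (π / 2)) (hxm : normalEqn P (-Q) x = m)
    (h : ∀ w ∈ Ioo 0 y, m < normalEqn P Q w) (hz : z ∈ Ioo (-y) x) : halfSlope P Q m z < 0 := by
  rcases lt_trichotomy z 0 with h0 | rfl | h0
  · have hz' : -z ∈ Ioo 0 (π / 2) := ⟨by linarith, by linarith [hz.1, hy.2]⟩
    have := h (-z) ⟨by linarith, by linarith [hz.1]⟩
    rw [← neg_neg z, halfSlope_neg_eq hz']
    exact mul_neg_of_pos_of_neg (mul_pos (sin_pos_of_mem_quadrant hz')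
      (cos_pos_of_mem_quadrant hz')) (by linarith)
  · simp [halfSlope, hQ]
  · have hz' : z ∈ Ioo 0 (π / 2) := ⟨h0, hz.2.trans hx.2⟩
    rw [halfSlope_eq hz']
    have := normalEqn_strictMonoOn hP hQ hz' hx hz.2
    exact mul_neg_of_pos_of_neg (mul_pos (sin_pos_of_mem_quadrant hz')
      (cos_pos_of_mem_quadrant hz')) (by linarith)

lemma halfSlope_neg_of_mem_Ioo_left (hP : 0 < P) (hQ : 0 < Q) {x y z : ℝ}
    (hx : x ∈ Ioo 0 (π / 2)) (hy : y ∈ Ioo 0 (π / 2)) (hxm : normalEqn P (-Q) x = -m)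
    (h : ∀ w ∈ Ioo y (π / 2), m < normalEqn P Q w) (hz : z ∈ Ioo (x - π) (-y)) :
    halfSlope P Q m z < 0 := by
  rcases lt_trichotomy z (-(π / 2)) with h0 | rfl | h0
  · have hz' : z + π ∈ Ioo 0 (π / 2) := ⟨by linarith [hz.1, hx.1], by linarith⟩
    rw [show z = z + π - π by ring, halfSlope_sub_pi_eq hz']
    have := normalEqn_strictMonoOn hP hQ hx hz' (by linarith [hz.1])
    exact mul_neg_of_pos_of_neg (mul_pos (sin_pos_of_mem_quadrant hz')
      (cos_pos_of_mem_quadrant hz')) (by linarith)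
  · simp [halfSlope, hP]
  · have hz' : -z ∈ Ioo 0 (π / 2) := ⟨by linarith [hz.2, hy.1], by linarith [hz.1]⟩
    have := h (-z) ⟨by linarith [hz.2], by linarith [hz.1]⟩
    rw [← neg_neg z, halfSlope_neg_eq hz']
    exact mul_neg_of_pos_of_neg (mul_pos (sin_pos_of_mem_quadrant hz')
      (cos_pos_of_mem_quadrant hz')) (by linarith)

lemma halfSlope_pos_of_mem_Ioo_neg {x y z : ℝ} (hx : 0 ≤ x) (hy : y ≤ π / 2)
    (h : ∀ w ∈ Ioo x y, normalEqn P Q w < m) (hz : z ∈ Ioo (-y) (-x)) :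
    0 < halfSlope P Q m z := by
  have hz' : -z ∈ Ioo 0 (π / 2) := ⟨by linarith [hz.2], by linarith [hz.1]⟩
  have := h (-z) ⟨by linarith [hz.2], by linarith [hz.1]⟩
  rw [← neg_neg z, halfSlope_neg_eq hz']
  exact mul_pos (mul_pos (sin_pos_of_mem_quadrant hz')
    (cos_pos_of_mem_quadrant hz')) (by linarith)

variable (hP : 0 < P) (hQ : 0 < Q) (hm : 0 < m)
  (hf : ∀ x, HasDerivAt f (2 * halfSlope P Q m x) x) (hper : Function.Periodic f (2 * π))
  {x y c : ℝ} (hx : x ∈ Ioo 0 (π / 2)) (hy : y ∈ Ioo 0 (π / 2)) (hc : c ∈ Ioo 0 (π / 2))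
  (hxm : normalEqn P (-Q) x = m) (hym : normalEqn P (-Q) y = -m) (hc0 : cubicSlope P Q c = 0)

include hP hQ hf hx hy hc hxm hym hc0 in
lemma strictAntiOn_of_le_normalEqn (hcm : m ≤ normalEqn P Q c) :
    StrictAntiOn f (Icc (y - π) x) := by
  have h1 : StrictAntiOn f (Icc (y - π) (-c)) := strictAntiOn_of_halfSlope_neg hf fun z hz =>
    halfSlope_neg_of_mem_Ioo_left hP hQ hy hc hym (fun w hw => hcm.trans_lt
      (normalEqn_lt_of_cubicSlope_nonneg hP hQ hc ⟨hc.1.trans hw.1, hw.2⟩ hw.1 hc0.ge)) hz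
  have h2 : StrictAntiOn f (Icc (-c) x) := strictAntiOn_of_halfSlope_neg hf fun z hz =>
    halfSlope_neg_of_mem_Ioo_right hP hQ hx hc hxm (fun w hw => hcm.trans_lt
      (normalEqn_lt_of_cubicSlope_nonpos hP hQ ⟨hw.1, hw.2.trans hc.2⟩ hc hw.2 hc0.le)) hz
  have h3 : y - π ≤ -c := by linarith [hy.2, hc.2]
  have h4 : -c ≤ x := by linarith [hx.1, hc.1]
  rw [← Icc_union_Icc_eq_Icc h3 h4]
  exact h1.union h2 (isGreatest_Icc h3) (isLeast_Icc h4)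

include hP hQ hf hx hy hc hxm hym hc0 in
lemma strictAntiOn_strictMonoOn_strictAntiOn {u w : ℝ} (hu : u ∈ Ioo 0 c)
    (hw : w ∈ Ioo c (π / 2)) (hum : normalEqn P Q u = m) (hwm : normalEqn P Q w = m) :
    StrictAntiOn f (Icc (y - π) (-w)) ∧ StrictMonoOn f (Icc (-w) (-u)) ∧
      StrictAntiOn f (Icc (-u) x) := by
  have hu' : u ∈ Ioo 0 (π / 2) := ⟨hu.1, hu.2.trans hc.2⟩
  have hw' : w ∈ Ioo 0 (π / 2) := ⟨hc.1.trans hw.1, hw.2⟩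
  have hmono := cubicSlope_strictMonoOn hP hQ
  have hu0 : cubicSlope P Q u ≤ 0 := hc0 ▸ (hmono hu' hc hu.2).le
  have hw0 : 0 ≤ cubicSlope P Q w := hc0 ▸ (hmono hc hw' hw.1).le
  refine ⟨strictAntiOn_of_halfSlope_neg hf fun z hz =>
    halfSlope_neg_of_mem_Ioo_left hP hQ hy hw' hym (fun s hs => hwm ▸
      (normalEqn_lt_of_cubicSlope_nonneg hP hQ hw' ⟨hw'.1.trans hs.1, hs.2⟩ hs.1 hw0)) hz,
    strictMonoOn_of_halfSlope_pos hf fun z hz =>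
      halfSlope_pos_of_mem_Ioo_neg hu'.1.le hw'.2.le (fun s hs => ?_) hz,
    strictAntiOn_of_halfSlope_neg hf fun z hz =>
    halfSlope_neg_of_mem_Ioo_right hP hQ hx hu' hxm (fun s hs => hum ▸
      (normalEqn_lt_of_cubicSlope_nonpos hP hQ ⟨hs.1, hs.2.trans hu'.2⟩ hu' hs.2 hu0)) hz⟩
  have hs' : s ∈ Ioo 0 (π / 2) := ⟨hu'.1.trans hs.1, hs.2.trans hw'.2⟩
  rcases le_total s c with h | h
  · exact hum ▸ normalEqn_lt_of_cubicSlope_nonpos hP hQ hu' hs' hs.1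
      (hc0 ▸ hmono.monotoneOn hs' hc h)
  · exact hwm ▸ normalEqn_lt_of_cubicSlope_nonneg hP hQ hs' hw' hs.2
      (hc0 ▸ hmono.monotoneOn hc hs' h)

include hper in
lemma apply_add_pi_eq (y : ℝ) : f (y + π) = f (y - π) := by
  rw [← hper (y - π)]
  congr 1
  ring

include hP hQ hm hf hx hy hxm hym in
lemma strictMonoOn_Icc_add_pi : StrictMonoOn f (Icc x (y + π)) :=
  strictMonoOn_of_halfSlope_pos hf fun _ hz => halfSlope_pos_of_mem_Ioo hP hQ hm hx hy hxm hym hz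

variable {v : ℝ}

include hP hQ hm hf hper hx hy hxm hym in
lemma ncard_eq_two_of_existsUnique (hxv : f x < v) (hyv : v < f (y - π))
    (h : ∃! z, z ∈ Icc (y - π) x ∧ f z = v) :
    {θ ∈ Ico (y - π) (y + π) | f θ = v}.ncard = 2 := by
  have hpi := pi_pos
  rw [← apply_add_pi_eq hper] at hyv
  have h2 : x ≤ y + π := by linarith [hx.2, hy.1]
  refine ncard_levelSet_eq_two (by linarith [hx.1, hy.2]) h2 h ?_ hxv.ne hyv.ne'
  exact existsUnique_eq_of_strictMonoOn (continuous_iff_continuousAt.2 fun z => (hf z).continuousAt)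
    h2 (strictMonoOn_Icc_add_pi hP hQ hm hf hx hy hxm hym) hxv hyv

include hP hQ hm hf hper hx hy hc hxm hym hc0 in
lemma ncard_eq_two_of_le_normalEqn (hxv : f x < v) (hyv : v < f (y - π))
    (hcm : m ≤ normalEqn P Q c) : {θ ∈ Ico (y - π) (y + π) | f θ = v}.ncard = 2 :=
  ncard_eq_two_of_existsUnique hP hQ hm hf hper hx hy hxm hym hxv hyv <|
    existsUnique_eq_of_strictAntiOn (continuous_iff_continuousAt.2 fun z => (hf z).continuousAt)
      (by linarith [hx.1, hy.2, pi_pos])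
      (strictAntiOn_of_le_normalEqn hP hQ hf hx hy hc hxm hym hc0 hcm) hyv hxv

include hP hQ hm hf hper hx hy hc hxm hym hc0 in
lemma ncard_eq_two_iff_of_normalEqn_eq (hxv : f x < v) (hyv : v < f (y - π)) {u w : ℝ}
    (hu : u ∈ Ioo 0 c) (hw : w ∈ Ioo c (π / 2)) (hum : normalEqn P Q u = m)
    (hwm : normalEqn P Q w = m) (huv : f (-u) ≠ v) (hwv : f (-w) ≠ v) :
    {θ ∈ Ico (y - π) (y + π) | f θ = v}.ncard = 2 ↔ ¬ (f (-w) < v ∧ v < f (-u)) := by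
  obtain ⟨h1, h2, h3⟩ := strictAntiOn_strictMonoOn_strictAntiOn hP hQ hf hx hy hc hxm hym hc0
    hu hw hum hwm
  have hcont : Continuous f := continuous_iff_continuousAt.2 fun z => (hf z).continuousAt
  have hpi := pi_pos
  have l1 : y - π ≤ -w := by linarith [hy.2, hw.2]
  have l2 : -w < -u := by linarith [hu.2, hw.1]
  have l3 : -u ≤ x := by linarith [hu.1, hx.1]
  have hwu : f (-w) < f (-u) := h2 (left_mem_Icc.2 l2.le) (right_mem_Icc.2 l2.le) l2
  constructor
  · rintro h ⟨hwv', huv'⟩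
    obtain ⟨z1, ⟨m1, e1⟩, -⟩ := existsUnique_eq_of_strictAntiOn hcont l1 h1 hyv hwv'
    obtain ⟨z2, ⟨m2, e2⟩, -⟩ := existsUnique_eq_of_strictMonoOn hcont l2.le h2 hwv' huv'
    obtain ⟨z3, ⟨m3, e3⟩, -⟩ := existsUnique_eq_of_strictAntiOn hcont l3 h3 huv' hxv
    have n1 : z1 < z2 := lt_of_le_of_ne (m1.2.trans m2.1) fun h => by
      have : z1 = -w := le_antisymm m1.2 (h ▸ m2.1)
      exact hwv (this ▸ e1)
    have n2 : z2 < z3 := lt_of_le_of_ne (m2.2.trans m3.1) fun h => by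
      have : z2 = -u := le_antisymm m2.2 (h ▸ m3.1)
      exact huv (this ▸ e2)
    have n3 : z3 < y + π := by linarith [m3.2, hx.2, hy.1]
    have k1 : z1 ∈ {θ ∈ Ico (y - π) (y + π) | f θ = v} := ⟨⟨m1.1, by linarith⟩, e1⟩
    have k2 : z2 ∈ {θ ∈ Ico (y - π) (y + π) | f θ = v} := ⟨⟨by linarith [m1.1], by linarith⟩, e2⟩
    have k3 : z3 ∈ {θ ∈ Ico (y - π) (y + π) | f θ = v} := ⟨⟨by linarith [m1.1], by linarith⟩, e3⟩
    exact ncard_ne_two_of_three k1 k2 k3 n1.ne n2.ne (n1.trans n2).ne h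
  · intro h
    refine ncard_eq_two_of_existsUnique hP hQ hm hf hper hx hy hxm hym hxv hyv ?_
    rcases hwv.lt_or_gt with hwv' | hwv'
    · have huv' : f (-u) < v := lt_of_le_of_ne (not_lt.1 fun h' => h ⟨hwv', h'⟩) huv
      obtain ⟨z, ⟨hz, e⟩, hz'⟩ := existsUnique_eq_of_strictAntiOn hcont l1 h1 hyv hwv'
      refine ⟨z, ⟨⟨hz.1, by linarith [hz.2]⟩, e⟩, fun s hs => hz' s ⟨⟨hs.1.1, ?_⟩, hs.2⟩⟩
      by_contra! hsw
      have : f s ≤ f (-u) := by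
        rcases le_total s (-u) with h' | h'
        · exact h2.monotoneOn ⟨hsw.le, h'⟩ (right_mem_Icc.2 l2.le) h'
        · exact h3.antitoneOn (left_mem_Icc.2 l3) ⟨h', hs.1.2⟩ h'
      linarith [hs.2]
    · obtain ⟨z, ⟨hz, e⟩, hz'⟩ := existsUnique_eq_of_strictAntiOn hcont l3 h3
        (hwv'.trans hwu) hxv
      refine ⟨z, ⟨⟨by linarith [hz.1], hz.2⟩, e⟩, fun s hs => hz' s ⟨⟨?_, hs.1.2⟩, hs.2⟩⟩
      by_contra! hsu
      have : f (-w) ≤ f s := by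
        rcases le_total s (-w) with h' | h'
        · exact h1.antitoneOn ⟨hs.1.1, h'⟩ (right_mem_Icc.2 l1) h'
        · exact h2.monotoneOn (left_mem_Icc.2 l2.le) ⟨h', hsu.le⟩ h'
      linarith [hs.2]

include hP hQ hf hx hxm in
lemma strictAntiOn_Icc_zero : StrictAntiOn f (Icc 0 x) :=
  strictAntiOn_of_halfSlope_neg hf fun z hz => by
    have hz' : z ∈ Ioo 0 (π / 2) := ⟨hz.1, hz.2.trans hx.2⟩
    rw [halfSlope_eq hz']
    have := normalEqn_strictMonoOn hP hQ hz' hx hz.2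
    exact mul_neg_of_pos_of_neg (mul_pos (sin_pos_of_mem_quadrant hz')
      (cos_pos_of_mem_quadrant hz')) (by linarith)

include hP hQ hf hy hym in
lemma strictAntiOn_Icc_neg_pi_div_two : StrictAntiOn f (Icc (y - π) (-(π / 2))) :=
  strictAntiOn_of_halfSlope_neg hf fun z hz => by
    have hz' : z + π ∈ Ioo 0 (π / 2) := ⟨by linarith [hz.1, hy.1], by linarith [hz.2]⟩
    rw [show z = z + π - π by ring, halfSlope_sub_pi_eq hz']
    have := normalEqn_strictMonoOn hP hQ hy hz' (by linarith [hz.1])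
    exact mul_neg_of_pos_of_neg (mul_pos (sin_pos_of_mem_quadrant hz')
      (cos_pos_of_mem_quadrant hz')) (by linarith)

variable (hr1 : ∀ θ ∈ Icc 0 (π / 2), f θ ≤ f (-θ)) (hr2 : ∀ θ ∈ Icc 0 (π / 2), f (-θ) ≤ f (θ - π))

include hP hQ hm hf hx hy hxm hym hr1 in
lemma apply_nearest_le {s : ℝ} (hs : s ∈ Icc (y - π) (y + π)) : f x ≤ f s := by
  have hmono := (strictMonoOn_Icc_add_pi hP hQ hm hf hx hy hxm hym).monotoneOn
  have hanti := (strictAntiOn_Icc_zero hP hQ hf hx hxm).antitoneOn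
  have hanti' := (strictAntiOn_Icc_neg_pi_div_two hP hQ hf hy hym).antitoneOn
  have hpi := pi_pos
  have hx2 := hx.2
  have hy1 := hy.1
  have hy2 := hy.2
  have h1 : ∀ t ∈ Icc 0 (y + π), f x ≤ f t := fun t ht => by
    rcases le_total x t with h | h
    · exact hmono ⟨le_rfl, by linarith⟩ ⟨h, ht.2⟩ h
    · exact hanti ⟨ht.1, h⟩ ⟨hx.1.le, le_rfl⟩ h
  have h2 : ∀ t ∈ Icc (-(π / 2)) 0, f x ≤ f t := fun t ht => by
    have := hr1 (-t) ⟨by linarith [ht.2], by linarith [ht.1]⟩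
    rw [neg_neg] at this
    exact (h1 (-t) ⟨by linarith [ht.2], by linarith [ht.1]⟩).trans this
  rcases le_total 0 s with h | h
  · exact h1 s ⟨h, hs.2⟩
  rcases le_total (-(π / 2)) s with h' | h'
  · exact h2 s ⟨h', h⟩
  · exact (h2 _ ⟨le_rfl, by linarith⟩).trans (hanti' ⟨hs.1, h'⟩ ⟨by linarith, le_rfl⟩ h')

include hP hQ hm hf hper hx hy hxm hym hr2 in
lemma apply_le_farthest {s : ℝ} (hs : s ∈ Icc (y - π) (y + π)) : f s ≤ f (y - π) := by
  have hmono := (strictMonoOn_Icc_add_pi hP hQ hm hf hx hy hxm hym).monotoneOn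
  have hanti := (strictAntiOn_Icc_zero hP hQ hf hx hxm).antitoneOn
  have hanti' := (strictAntiOn_Icc_neg_pi_div_two hP hQ hf hy hym).antitoneOn
  have hpi := pi_pos
  have hx2 := hx.2
  have hy1 := hy.1
  have hy2 := hy.2
  have h1 : ∀ t ∈ Icc x (y + π), f t ≤ f (y - π) := fun t ht => by
    rw [← apply_add_pi_eq hper]
    exact hmono ht ⟨by linarith, le_rfl⟩ ht.2
  have h2 : ∀ t ∈ Icc (-π) (-(π / 2)), f t ≤ f (y - π) := fun t ht => by
    rcases le_total (y - π) t with h | h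
    · exact hanti' ⟨le_rfl, by linarith⟩ ⟨h, ht.2⟩ h
    · rw [← hper t]
      exact h1 _ ⟨by linarith [ht.1], by linarith⟩
  have h3 : ∀ t ∈ Icc (-(π / 2)) 0, f t ≤ f (y - π) := fun t ht => by
    have := hr2 (-t) ⟨by linarith [ht.2], by linarith [ht.1]⟩
    rw [neg_neg] at this
    exact this.trans (h2 _ ⟨by linarith [ht.2], by linarith [ht.1]⟩)
  rcases le_total x s with h | h
  · exact h1 s ⟨h, hs.2⟩
  rcases le_total 0 s with h0 | h0
  · exact (hanti ⟨le_rfl, hx.1.le⟩ ⟨h0, h⟩ h0).trans (h3 0 ⟨by linarith, le_rfl⟩)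
  rcases le_total (-(π / 2)) s with h' | h'
  · exact h3 s ⟨h', h0⟩
  · exact hanti' ⟨le_rfl, by linarith⟩ ⟨hs.1, h'⟩ hs.1

end LevelSet

/-- The speed of the parametrization `x ↦ (a cos x, b sin x)` of an ellipse. -/
def speed (a b x : ℝ) : ℝ := √(a ^ 2 * sin x ^ 2 + b ^ 2 * cos x ^ 2)

lemma speed_neg_left (a b x : ℝ) : speed (-a) b x = speed a b x := by simp [speed]

lemma speed_neg_right (a b x : ℝ) : speed a (-b) x = speed a b x := by simp [speed]

lemma speed_arg_pos {a b : ℝ} (ha : a ≠ 0) (hb : b ≠ 0) (x : ℝ) :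
    0 < a ^ 2 * sin x ^ 2 + b ^ 2 * cos x ^ 2 := by
  have h := sin_sq_add_cos_sq x
  rcases eq_or_ne (sin x) 0 with h0 | h0
  · rw [h0] at h ⊢
    have : cos x ^ 2 = 1 := by linarith
    rw [this]
    positivity
  · positivity

lemma speed_pos {a b : ℝ} (ha : a ≠ 0) (hb : b ≠ 0) (x : ℝ) : 0 < speed a b x :=
  sqrt_pos.2 (speed_arg_pos ha hb x)

lemma speed_sq (a b x : ℝ) : speed a b x ^ 2 = a ^ 2 * sin x ^ 2 + b ^ 2 * cos x ^ 2 :=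
  sq_sqrt (by positivity)

lemma speed_le {a b : ℝ} (hb : 0 < b) (hba : b < a) (x : ℝ) : speed a b x ≤ a := by
  refine abs_le_of_sq_le_sq' ?_ (hb.trans hba).le |>.2
  rw [speed_sq]
  rw [sin_sq]
  nlinarith [mul_nonneg (sub_nonneg.2 (pow_le_pow_left₀ hb.le hba.le 2)) (sq_nonneg (cos x))]

lemma le_speed {a b : ℝ} (hb : 0 < b) (hba : b < a) (x : ℝ) : b ≤ speed a b x := by
  refine abs_le_of_sq_le_sq' ?_ (speed_pos (hb.trans hba).ne' hb.ne' x).le |>.2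
  rw [speed_sq]
  rw [cos_sq']
  nlinarith [mul_nonneg (sub_nonneg.2 (pow_le_pow_left₀ hb.le hba.le 2)) (sq_nonneg (sin x))]

/-- The point at signed distance `z.2` from `(A cos z.1, B sin z.1)` on the normal line there. -/
def normalMap (A B : ℝ) (z : ℝ × ℝ) : ℝ × ℝ :=
  (cos z.1 * (A + z.2 * B / speed A B z.1), sin z.1 * (B + z.2 * A / speed A B z.1))

/-- The squared distance from `(p, q)` to `(a cos x, b sin x)`. -/
def sqDist (a b p q x : ℝ) : ℝ := (a * cos x - p) ^ 2 + (b * sin x - q) ^ 2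

lemma sqDist_neg_right (a b p q x : ℝ) : sqDist a (-b) p q x = sqDist a b p q (-x) := by
  simp [sqDist]

lemma sqDist_neg_neg (a b p q x : ℝ) : sqDist (-a) (-b) p q x = sqDist a b p q (x - π) := by
  simp [sqDist, cos_sub_pi, sin_sub_pi]

lemma hasDerivAt_sqDist (a b p q x : ℝ) :
    HasDerivAt (sqDist a b p q) (2 * halfSlope (a * p) (b * q) (a ^ 2 - b ^ 2) x) x := by
  convert! ((((hasDerivAt_cos x).const_mul a).sub_const p).pow 2).add
    ((((hasDerivAt_sin x).const_mul b).sub_const q).pow 2) using 1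
  simp only [halfSlope]
  ring

lemma periodic_sqDist (a b p q : ℝ) : Function.Periodic (sqDist a b p q) (2 * π) := fun x => by
  simp [sqDist]

section Normal

variable {A B x t p q : ℝ}

lemma normalEqn_of_normalMap_eq (hA : A ≠ 0) (hB : B ≠ 0) (hx : x ∈ Ioo 0 (π / 2))
    (h : normalMap A B (x, t) = (p, q)) : normalEqn (A * p) (-(B * q)) x = A ^ 2 - B ^ 2 := by
  obtain ⟨rfl, rfl⟩ := Prod.mk.inj h
  have hs := (sin_pos_of_mem_quadrant hx).ne'
  have hc := (cos_pos_of_mem_quadrant hx).ne'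
  have hw := (speed_pos hA hB x).ne'
  simp only [normalEqn]
  field_simp
  ring

lemma exists_normalMap_eq (hA : A ≠ 0) (hB : B ≠ 0) (hx : x ∈ Ioo 0 (π / 2))
    (h : normalEqn (A * p) (-(B * q)) x = A ^ 2 - B ^ 2) : ∃ t, normalMap A B (x, t) = (p, q) := by
  have hs := (sin_pos_of_mem_quadrant hx).ne'
  have hc := (cos_pos_of_mem_quadrant hx).ne'
  have hw := (speed_pos hA hB x).ne'
  refine ⟨speed A B x * (p / cos x - A) / B, Prod.ext ?_ ?_⟩
  · simp only [normalMap]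
    field_simp
    ring
  · simp only [normalMap]
    simp only [normalEqn] at h
    field_simp at h ⊢
    linear_combination h

lemma sqDist_of_normalMap_eq (hA : A ≠ 0) (hB : B ≠ 0)
    (h : normalMap A B (x, t) = (p, q)) : sqDist A B p q x = t ^ 2 := by
  obtain ⟨rfl, rfl⟩ := Prod.mk.inj h
  have hw := (speed_pos hA hB x).ne'
  simp only [sqDist]
  field_simp
  rw [speed_sq]
  ring

lemma cubicSlope_of_normalMap_eq (hA : A ≠ 0) (hB : B ≠ 0)
    (h : normalMap A B (x, t) = (p, q)) :
    cubicSlope (A * p) (-(B * q)) x =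
      sin x * cos x * (speed A B x ^ 3 + t * (A * B)) / speed A B x := by
  obtain ⟨rfl, rfl⟩ := Prod.mk.inj h
  have hw := (speed_pos hA hB x).ne'
  simp only [cubicSlope]
  rw [eq_div_iff hw]
  have h2 := speed_sq A B x
  field_simp
  linear_combination (-(cos x * sin x * speed A B x)) * h2 +
    cos x * sin x * A * t * B * sin_sq_add_cos_sq x

lemma normalMap_pos_iff (hA : A ≠ 0) (hB : B ≠ 0) (hx : x ∈ Ioo 0 (π / 2))
    (h : normalMap A B (x, t) = (p, q)) :
    (0 < p ↔ 0 < A * speed A B x + t * B) ∧ (0 < q ↔ 0 < B * speed A B x + t * A) := by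
  obtain ⟨rfl, rfl⟩ := Prod.mk.inj h
  have hs := sin_pos_of_mem_quadrant hx
  have hc := cos_pos_of_mem_quadrant hx
  have hw := speed_pos hA hB x
  simp only [mul_pos_iff_of_pos_left hs, mul_pos_iff_of_pos_left hc]
  constructor
  · rw [← mul_pos_iff_of_pos_right hw, add_mul, div_mul_cancel₀ _ hw.ne']
  · rw [← mul_pos_iff_of_pos_right hw, add_mul, div_mul_cancel₀ _ hw.ne']

end Normal

/-- Normal coordinates of the points of the open first quadrant whose nearest point of the ellipse
is at distance less than `r`. -/
def nearRegion (a b r : ℝ) : Set (ℝ × ℝ) :=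
  {z | z.1 ∈ Ioo 0 (π / 2) ∧ z.2 ∈ Ioo (-(b * speed a b z.1 / a)) r}

/-- Normal coordinates of the points of the open first quadrant whose farthest point of the ellipse
is at distance less than `r`. -/
def farRegion (a b r : ℝ) : Set (ℝ × ℝ) :=
  {z | z.1 ∈ Ioo 0 (π / 2) ∧ z.2 ∈ Ioo (-r) (-(a * speed a b z.1 / b))}

/-- Normal coordinates of the points of the open first quadrant for which the distance to the
ellipse has a local minimum less than `r` in the fourth quadrant. -/
def minRegion (a b r : ℝ) : Set (ℝ × ℝ) :=
  {z | z.1 ∈ Ioo 0 (π / 2) ∧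
    z.2 ∈ Ioo (b * speed a b z.1 / a) (min r (speed a b z.1 ^ 3 / (a * b)))}

/-- Normal coordinates of the points of the open first quadrant for which the distance to the
ellipse has a local maximum less than `r` in the fourth quadrant. -/
def maxRegion (a b r : ℝ) : Set (ℝ × ℝ) :=
  {z | z.1 ∈ Ioo 0 (π / 2) ∧
    z.2 ∈ Ioo (speed a b z.1 ^ 3 / (a * b)) (min r (a * speed a b z.1 / b))}

/-- Normal coordinates at distance exactly `r` from the ellipse. -/
def offsetRegion (r : ℝ) : Set (ℝ × ℝ) :=
  {z | z.1 ∈ Ioo 0 (π / 2) ∧ z.2 ^ 2 = r ^ 2}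

section Region

variable {a b r p q : ℝ} (hb : 0 < b) (hba : b < a) (hr : a < r) (hp : 0 < p) (hq : 0 < q)

include hb hba hr in
lemma mul_speed_div_lt (x : ℝ) : b * speed a b x / a < r := by
  have ha := hb.trans hba
  rw [div_lt_iff₀ ha]
  have := mul_le_mul_of_nonneg_left (speed_le hb hba x) hb.le
  nlinarith

include hb hba in
lemma pow_speed_div_le (x : ℝ) : speed a b x ^ 3 / (a * b) ≤ a * speed a b x / b := by
  have ha := hb.trans hba
  rw [div_le_div_iff₀ (by positivity) hb]
  have h1 := speed_le hb hba x
  have h2 := speed_pos ha.ne' hb.ne' x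
  have h3 : speed a b x ^ 2 ≤ a ^ 2 := pow_le_pow_left₀ h2.le h1 2
  have := mul_le_mul_of_nonneg_left h3 (mul_pos h2 hb).le
  nlinarith

include hb hba in
lemma mul_speed_div_le_pow (x : ℝ) : b * speed a b x / a ≤ speed a b x ^ 3 / (a * b) := by
  have ha := hb.trans hba
  rw [div_le_div_iff₀ ha (by positivity)]
  have h1 := le_speed hb hba x
  have h2 := speed_pos ha.ne' hb.ne' x
  have h3 : b ^ 2 ≤ speed a b x ^ 2 := pow_le_pow_left₀ hb.le h1 2
  have := mul_le_mul_of_nonneg_left h3 (mul_pos h2 ha).le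
  nlinarith

include hb hba hr hp hq in
lemma mem_image_nearRegion_iff {x : ℝ} (hx : x ∈ Ioo 0 (π / 2))
    (hxm : normalEqn (a * p) (-(b * q)) x = a ^ 2 - b ^ 2) :
    (p, q) ∈ normalMap a b '' nearRegion a b r ↔ sqDist a b p q x < r ^ 2 := by
  have ha := hb.trans hba
  have hr0 := ha.trans hr
  constructor
  · rintro ⟨⟨y, t⟩, ⟨hy, ht1, ht2⟩, h⟩
    have hy' := normalEqn_of_normalMap_eq ha.ne' hb.ne' hy h
    obtain rfl := (normalEqn_strictMonoOn (mul_pos ha hp) (mul_pos hb hq)).injOn hx hy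
      (hxm.trans hy'.symm)
    rw [sqDist_of_normalMap_eq ha.ne' hb.ne' h]
    have := mul_speed_div_lt hb hba hr x
    simp only at ht1 ht2
    exact sq_lt_sq' (by linarith) ht2
  · intro h
    obtain ⟨t, ht⟩ := exists_normalMap_eq ha.ne' hb.ne' hx hxm
    rw [sqDist_of_normalMap_eq ha.ne' hb.ne' ht] at h
    refine ⟨(x, t), ⟨hx, ?_, (abs_lt_of_sq_lt_sq' h hr0.le).2⟩, ht⟩
    have := (normalMap_pos_iff ha.ne' hb.ne' hx ht).2.1 hq
    rw [neg_lt, lt_div_iff₀ ha] at *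
    simp only
    linarith

include hb hba hr hp hq in
lemma mem_image_farRegion_iff {x : ℝ} (hx : x ∈ Ioo 0 (π / 2))
    (hxm : normalEqn (a * p) (-(b * q)) x = -(a ^ 2 - b ^ 2)) :
    (p, q) ∈ normalMap (-a) (-b) '' farRegion a b r ↔ sqDist a b p q (x - π) < r ^ 2 := by
  have ha := hb.trans hba
  have hr0 := ha.trans hr
  have hA : -a ≠ 0 := neg_ne_zero.2 ha.ne'
  have hB : -b ≠ 0 := neg_ne_zero.2 hb.ne'
  have hneg : ∀ y, normalEqn (-a * p) (-(-b * q)) y = -normalEqn (a * p) (-(b * q)) y := by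
    intro y; simp only [normalEqn]; ring
  rw [← sqDist_neg_neg]
  constructor
  · rintro ⟨⟨y, t⟩, ⟨hy, ht1, ht2⟩, h⟩
    have hy' := normalEqn_of_normalMap_eq hA hB hy h
    rw [hneg] at hy'
    obtain rfl := (normalEqn_strictMonoOn (mul_pos ha hp) (mul_pos hb hq)).injOn hx hy
      (show _ = _ by linarith)
    rw [sqDist_of_normalMap_eq hA hB h]
    have : 0 < a * speed a b x / b :=
      div_pos (mul_pos ha (speed_pos ha.ne' hb.ne' x)) hb
    simp only at ht1 ht2
    exact sq_lt_sq' ht1 (by linarith)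
  · intro h
    obtain ⟨t, ht⟩ := exists_normalMap_eq (p := p) (q := q) hA hB hx (by rw [hneg, hxm]; ring)
    rw [sqDist_of_normalMap_eq hA hB ht] at h
    refine ⟨(x, t), ⟨hx, (abs_lt_of_sq_lt_sq' h hr0.le).1, ?_⟩, ht⟩
    have := (normalMap_pos_iff hA hB hx ht).1.1 hp
    rw [speed_neg_left, speed_neg_right] at this
    simp only
    rw [lt_neg, div_lt_iff₀ hb]
    linarith

include hb hba hr hq in
lemma mem_image_minRegion_iff :
    (p, q) ∈ normalMap a (-b) '' minRegion a b r ↔ ∃ x ∈ Ioo 0 (π / 2),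
      normalEqn (a * p) (b * q) x = a ^ 2 - b ^ 2 ∧ 0 < cubicSlope (a * p) (b * q) x ∧
      sqDist a b p q (-x) < r ^ 2 := by
  have ha := hb.trans hba
  have hr0 := ha.trans hr
  have hB : -b ≠ 0 := neg_ne_zero.2 hb.ne'
  have hab := mul_pos ha hb
  simp only [← sqDist_neg_right]
  constructor
  · rintro ⟨⟨x, t⟩, ⟨hx, ht1, ht2⟩, h⟩
    have hx' := normalEqn_of_normalMap_eq ha.ne' hB hx h
    have hk := cubicSlope_of_normalMap_eq ha.ne' hB h
    have hw := speed_pos ha.ne' hb.ne' x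
    simp only [neg_mul, neg_neg, neg_sq, speed_neg_right] at hx' hk
    rw [lt_min_iff] at ht2
    simp only at ht1 ht2
    refine ⟨x, hx, hx', ?_, ?_⟩
    · rw [hk]
      have := sin_pos_of_mem_quadrant hx
      have := cos_pos_of_mem_quadrant hx
      have := (lt_div_iff₀ hab).1 ht2.2
      exact div_pos (mul_pos (by positivity) (by linarith)) hw
    · rw [sqDist_of_normalMap_eq ha.ne' hB h]
      have : 0 < b * speed a b x / a := div_pos (mul_pos hb hw) ha
      exact sq_lt_sq' (by linarith) ht2.1
  · rintro ⟨x, hx, hx', hk, hr'⟩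
    obtain ⟨t, ht⟩ := exists_normalMap_eq (p := p) (q := q) ha.ne' hB hx (by simpa using hx')
    have hk' := cubicSlope_of_normalMap_eq ha.ne' hB ht
    have hw := speed_pos ha.ne' hb.ne' x
    rw [sqDist_of_normalMap_eq ha.ne' hB ht] at hr'
    simp only [neg_mul, neg_neg, speed_neg_right] at hk'
    rw [hk'] at hk
    refine ⟨(x, t), ⟨hx, ?_, lt_min (abs_lt_of_sq_lt_sq' hr' hr0.le).2 ?_⟩, ht⟩
    · have := (normalMap_pos_iff ha.ne' hB hx ht).2.1 hq
      rw [speed_neg_right] at this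
      simp only
      rw [div_lt_iff₀ ha]
      linarith
    · have hsc := mul_pos (sin_pos_of_mem_quadrant hx) (cos_pos_of_mem_quadrant hx)
      have := (mul_pos_iff_of_pos_left hsc).1 ((div_pos_iff_of_pos_right hw).1 hk)
      simp only
      rw [lt_div_iff₀ hab]
      linarith

include hb hba hr hp in
lemma mem_image_maxRegion_iff :
    (p, q) ∈ normalMap a (-b) '' maxRegion a b r ↔ ∃ x ∈ Ioo 0 (π / 2),
      normalEqn (a * p) (b * q) x = a ^ 2 - b ^ 2 ∧ cubicSlope (a * p) (b * q) x < 0 ∧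
      sqDist a b p q (-x) < r ^ 2 := by
  have ha := hb.trans hba
  have hr0 := ha.trans hr
  have hB : -b ≠ 0 := neg_ne_zero.2 hb.ne'
  have hab := mul_pos ha hb
  simp only [← sqDist_neg_right]
  constructor
  · rintro ⟨⟨x, t⟩, ⟨hx, ht1, ht2⟩, h⟩
    have hx' := normalEqn_of_normalMap_eq ha.ne' hB hx h
    have hk := cubicSlope_of_normalMap_eq ha.ne' hB h
    have hw := speed_pos ha.ne' hb.ne' x
    simp only [neg_mul, neg_neg, neg_sq, speed_neg_right] at hx' hk
    rw [lt_min_iff] at ht2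
    simp only at ht1 ht2
    refine ⟨x, hx, hx', ?_, ?_⟩
    · rw [hk]
      have := sin_pos_of_mem_quadrant hx
      have := cos_pos_of_mem_quadrant hx
      have := (div_lt_iff₀ hab).1 ht1
      exact div_neg_of_neg_of_pos (mul_neg_of_pos_of_neg (by positivity) (by linarith)) hw
    · rw [sqDist_of_normalMap_eq ha.ne' hB h]
      have : 0 < speed a b x ^ 3 / (a * b) := by positivity
      exact sq_lt_sq' (by linarith) ht2.1
  · rintro ⟨x, hx, hx', hk, hr'⟩
    obtain ⟨t, ht⟩ := exists_normalMap_eq (p := p) (q := q) ha.ne' hB hx (by simpa using hx')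
    have hk' := cubicSlope_of_normalMap_eq ha.ne' hB ht
    have hw := speed_pos ha.ne' hb.ne' x
    rw [sqDist_of_normalMap_eq ha.ne' hB ht] at hr'
    simp only [neg_mul, neg_neg, speed_neg_right] at hk'
    rw [hk'] at hk
    refine ⟨(x, t), ⟨hx, ?_, lt_min (abs_lt_of_sq_lt_sq' hr' hr0.le).2 ?_⟩, ht⟩
    · have hsc := mul_pos (sin_pos_of_mem_quadrant hx) (cos_pos_of_mem_quadrant hx)
      have := (div_neg_iff.1 hk).resolve_left (fun h => h.2.not_gt hw)
      have := neg_of_mul_neg_right this.1 hsc.le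
      simp only
      rw [div_lt_iff₀ hab]
      linarith
    · have := (normalMap_pos_iff ha.ne' hB hx ht).1.1 hp
      rw [speed_neg_right] at this
      simp only
      rw [lt_div_iff₀ hb]
      linarith

end Region

lemma injOn_cos_sin (α : ℝ) : InjOn (fun θ => (cos θ, sin θ)) (Ico α (α + 2 * π)) := by
  intro x hx y hy h
  obtain ⟨hc, hs⟩ := Prod.mk.inj h
  have := Real.Angle.cos_sin_inj hc hs
  rw [Real.Angle.angle_eq_iff_two_pi_dvd_sub] at this
  obtain ⟨k, hk⟩ := this
  have hpi := pi_pos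
  have h1 : (k : ℝ) < 1 := by
    by_contra! h'
    nlinarith [hx.1, hx.2, hy.1, hy.2]
  have h2 : (-1 : ℝ) < k := by
    by_contra! h'
    nlinarith [hx.1, hx.2, hy.1, hy.2]
  have h3 : k = 0 := by
    have h1' : k < 1 := by exact_mod_cast h1
    have h2' : -1 < k := by exact_mod_cast h2
    omega
  rw [h3] at hk
  simp at hk
  linarith

lemma exists_cos_sin_eq (α : ℝ) {x y : ℝ} (h : x ^ 2 + y ^ 2 = 1) :
    ∃ θ ∈ Ico α (α + 2 * π), cos θ = x ∧ sin θ = y := by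
  have hn : ‖(⟨x, y⟩ : ℂ)‖ = 1 := by
    rw [Complex.norm_eq_sqrt_sq_add_sq, h, sqrt_one]
  have h0 : (⟨x, y⟩ : ℂ) ≠ 0 := fun h' => by simp [h'] at hn
  refine ⟨toIcoMod two_pi_pos α (Complex.arg ⟨x, y⟩), toIcoMod_mem_Ico _ _ _, ?_, ?_⟩
  · rw [toIcoMod, zsmul_eq_mul, cos_sub_int_mul_two_pi, Complex.cos_arg h0, hn, div_one]
  · rw [toIcoMod, zsmul_eq_mul, sin_sub_int_mul_two_pi, Complex.sin_arg, hn, div_one]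

lemma mem_sphere_iff_sq {p q r : ℝ} (hr : 0 ≤ r) (x : E2) :
    x ∈ sphere (!₂[p, q] : E2) r ↔ (x 0 - p) ^ 2 + (x 1 - q) ^ 2 = r ^ 2 := by
  rw [mem_sphere, EuclideanSpace.dist_eq, sqrt_eq_iff_eq_sq (by positivity) hr]
  simp [Fin.sum_univ_two, Real.dist_eq, sq_abs]

lemma ncard_sphere_inter_Cset {a b r : ℝ} (ha : a ≠ 0) (hb : b ≠ 0) (hr : 0 ≤ r) (p q α : ℝ) :
    (sphere (!₂[p, q] : E2) r ∩ Cset a b).ncard =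
      {θ ∈ Ico α (α + 2 * π) | sqDist a b p q θ = r ^ 2}.ncard := by
  have himg : sphere (!₂[p, q] : E2) r ∩ Cset a b =
      (fun θ => (!₂[a * cos θ, b * sin θ] : E2)) ''
        {θ ∈ Ico α (α + 2 * π) | sqDist a b p q θ = r ^ 2} := by
    ext x
    rw [mem_inter_iff, mem_sphere_iff_sq hr]
    constructor
    · rintro ⟨h1, h2⟩
      have h2' : (x 0 / a) ^ 2 + (x 1 / b) ^ 2 = 1 := by rw [div_pow, div_pow]; exact h2
      obtain ⟨θ, hθ, hc, hs⟩ := exists_cos_sin_eq α h2'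
      have e0 : a * cos θ = x 0 := by rw [hc]; field_simp
      have e1 : b * sin θ = x 1 := by rw [hs]; field_simp
      refine ⟨θ, ⟨hθ, ?_⟩, ?_⟩
      · rw [sqDist, e0, e1, h1]
      · ext i
        fin_cases i
        · simpa using e0
        · simpa using e1
    · rintro ⟨θ, ⟨-, h⟩, rfl⟩
      refine ⟨by simpa [sqDist] using h, ?_⟩
      simp only [Cset, mem_ofPred_eq, Matrix.cons_val_zero, Matrix.cons_val_one]
      field_simp
      linarith [sin_sq_add_cos_sq θ]
  rw [himg]
  refine InjOn.ncard_image fun x hx y hy h => injOn_cos_sin α hx.1 hy.1 ?_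
  have h0 := congrArg (fun z : E2 => z 0) h
  have h1 := congrArg (fun z : E2 => z 1) h
  simp only [Matrix.cons_val_zero, Matrix.cons_val_one] at h0 h1
  exact Prod.ext (mul_left_cancel₀ ha h0) (mul_left_cancel₀ hb h1)

/-- Centers of the circles of radius `r` that meet the ellipse in exactly two points. -/
def twoPointCenters (a b r : ℝ) : Set (ℝ × ℝ) :=
  {z | (sphere (!₂[z.1, z.2] : E2) r ∩ Cset a b).ncard = 2}

lemma sqDist_le_sqDist_neg {a b p q : ℝ} (hQ : 0 < b * q) {θ : ℝ} (hθ : θ ∈ Icc 0 (π / 2)) :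
    sqDist a b p q θ ≤ sqDist a b p q (-θ) := by
  have := sin_nonneg_of_nonneg_of_le_pi hθ.1 (by linarith [hθ.2, pi_pos])
  simp only [sqDist, cos_neg, sin_neg]
  nlinarith [mul_nonneg hQ.le this]

lemma sqDist_neg_le_sqDist_sub_pi {a b p q : ℝ} (hP : 0 < a * p) {θ : ℝ} (hθ : θ ∈ Icc 0 (π / 2)) :
    sqDist a b p q (-θ) ≤ sqDist a b p q (θ - π) := by
  have := cos_nonneg_of_neg_pi_div_two_le_of_le (by linarith [hθ.1, pi_pos]) hθ.2
  simp only [sqDist, cos_neg, sin_neg, cos_sub_pi, sin_sub_pi]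
  nlinarith [mul_nonneg hP.le this]

/-- The points at distance `r` from the ellipse along one of its normals. -/
def offsetImage (a b r : ℝ) : Set (ℝ × ℝ) :=
  normalMap a b '' offsetRegion r ∪ normalMap (-a) (-b) '' offsetRegion r ∪
    normalMap a (-b) '' offsetRegion r

lemma mem_image_offsetRegion {A B r p q x : ℝ} (hA : A ≠ 0) (hB : B ≠ 0) (hx : x ∈ Ioo 0 (π / 2))
    (hxm : normalEqn (A * p) (-(B * q)) x = A ^ 2 - B ^ 2) (h : sqDist A B p q x = r ^ 2) :
    (p, q) ∈ normalMap A B '' offsetRegion r := by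
  obtain ⟨t, ht⟩ := exists_normalMap_eq hA hB hx hxm
  exact ⟨(x, t), ⟨hx, (sqDist_of_normalMap_eq hA hB ht).symm.trans h⟩, ht⟩

section Quadrant

variable {a b r p q : ℝ} (hb : 0 < b) (hba : b < a) (hr : a < r) (hp : 0 < p) (hq : 0 < q)

include hb hba hr hp hq in
lemma mem_image_minRegion_maxRegion {c : ℝ} (hc : c ∈ Ioo 0 (π / 2))
    (hc0 : cubicSlope (a * p) (b * q) c = 0) :
    (a ^ 2 - b ^ 2 ≤ normalEqn (a * p) (b * q) c ∧
      (p, q) ∉ normalMap a (-b) '' minRegion a b r ∧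
      (p, q) ∉ normalMap a (-b) '' maxRegion a b r) ∨
    ∃ u ∈ Ioo 0 c, ∃ w ∈ Ioo c (π / 2),
      normalEqn (a * p) (b * q) u = a ^ 2 - b ^ 2 ∧ normalEqn (a * p) (b * q) w = a ^ 2 - b ^ 2 ∧
      ((p, q) ∈ normalMap a (-b) '' minRegion a b r ↔ sqDist a b p q (-w) < r ^ 2) ∧
      ((p, q) ∈ normalMap a (-b) '' maxRegion a b r ↔ sqDist a b p q (-u) < r ^ 2) := by
  have hP := mul_pos (hb.trans hba) hp
  have hQ := mul_pos hb hq
  have hmono := cubicSlope_strictMonoOn hP hQ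
  rw [mem_image_minRegion_iff hb hba hr hq, mem_image_maxRegion_iff hb hba hr hp]
  have hlt : ∀ x ∈ Ioo 0 (π / 2), cubicSlope (a * p) (b * q) x < 0 → x < c := fun x hx h => by
    by_contra! h'
    linarith [hmono.monotoneOn hc hx h']
  have hgt : ∀ x ∈ Ioo 0 (π / 2), 0 < cubicSlope (a * p) (b * q) x → c < x := fun x hx h => by
    by_contra! h'
    linarith [hmono.monotoneOn hx hc h']
  rcases le_or_gt (a ^ 2 - b ^ 2) (normalEqn (a * p) (b * q) c) with h | h
  · refine Or.inl ⟨h, ?_, ?_⟩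
    · rintro ⟨x, hx, hxm, hk, -⟩
      linarith [normalEqn_lt_of_cubicSlope_nonneg hP hQ hc hx (hgt x hx hk) hc0.ge]
    · rintro ⟨x, hx, hxm, hk, -⟩
      linarith [normalEqn_lt_of_cubicSlope_nonpos hP hQ hx hc (hlt x hx hk) hc0.le]
  · obtain ⟨⟨u, hu, hum⟩, ⟨w, hw, hwm⟩⟩ := exists_normalEqn_eq_eq hP hQ hc h
    have hu' : u ∈ Ioo 0 (π / 2) := ⟨hu.1, hu.2.trans hc.2⟩
    have hw' : w ∈ Ioo 0 (π / 2) := ⟨hc.1.trans hw.1, hw.2⟩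
    have hu0 : cubicSlope (a * p) (b * q) u < 0 := hc0 ▸ hmono hu' hc hu.2
    have hw0 : 0 < cubicSlope (a * p) (b * q) w := hc0 ▸ hmono hc hw' hw.1
    refine Or.inr ⟨u, hu, w, hw, hum, hwm, ⟨?_, fun h => ⟨w, hw', hwm, hw0, h⟩⟩,
      ⟨?_, fun h => ⟨u, hu', hum, hu0, h⟩⟩⟩
    · rintro ⟨x, hx, hxm, hk, hd⟩
      rcases lt_trichotomy x w with h' | rfl | h'
      · linarith [normalEqn_lt_of_cubicSlope_nonneg hP hQ hx hw' h' hk.le]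
      · exact hd
      · linarith [normalEqn_lt_of_cubicSlope_nonneg hP hQ hw' hx h' hw0.le]
    · rintro ⟨x, hx, hxm, hk, hd⟩
      rcases lt_trichotomy x u with h' | rfl | h'
      · linarith [normalEqn_lt_of_cubicSlope_nonpos hP hQ hx hu' h' hu0.le]
      · exact hd
      · linarith [normalEqn_lt_of_cubicSlope_nonpos hP hQ hu' hx h' hk.le]

include hb hba hr hp hq in
lemma mem_image_region_imp :
    ((p, q) ∈ normalMap (-a) (-b) '' farRegion a b r →
      (p, q) ∈ normalMap a b '' nearRegion a b r) ∧
    ((p, q) ∈ normalMap a (-b) '' maxRegion a b r →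
      (p, q) ∈ normalMap a (-b) '' minRegion a b r) ∧
    ((p, q) ∈ normalMap a (-b) '' minRegion a b r →
      (p, q) ∉ normalMap a (-b) '' maxRegion a b r →
      (p, q) ∈ normalMap a b '' nearRegion a b r ∧
      (p, q) ∉ normalMap (-a) (-b) '' farRegion a b r) := by
  have ha := hb.trans hba
  have hm : 0 < a ^ 2 - b ^ 2 := sub_pos.2 (pow_lt_pow_left₀ hba hb.le two_ne_zero)
  have hP := mul_pos ha hp
  have hQ := mul_pos hb hq
  have hpi := pi_pos
  have hf := hasDerivAt_sqDist a b p q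
  have hper := periodic_sqDist a b p q
  obtain ⟨x, hx, hxm⟩ := exists_normalEqn_eq hP hQ (a ^ 2 - b ^ 2)
  obtain ⟨y, hy, hym⟩ := exists_normalEqn_eq hP hQ (-(a ^ 2 - b ^ 2))
  obtain ⟨c, hc, hc0⟩ := exists_cubicSlope_eq_zero hP hQ
  have hnear := fun s => apply_nearest_le (s := s) hP hQ hm hf hx hy hxm hym
    fun θ hθ => sqDist_le_sqDist_neg hQ hθ
  have hfar := fun s => apply_le_farthest (s := s) hP hQ hm hf hper hx hy hxm hym
    fun θ hθ => sqDist_neg_le_sqDist_sub_pi hP hθ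
  rw [mem_image_farRegion_iff hb hba hr hp hq hy hym,
    mem_image_nearRegion_iff hb hba hr hp hq hx hxm]
  refine ⟨fun h => (hnear _ ⟨le_rfl, by linarith⟩).trans_lt h, ?_⟩
  rcases mem_image_minRegion_maxRegion hb hba hr hp hq hc hc0 with
    ⟨-, h1, h2⟩ | ⟨u, hu, w, hw, hum, hwm, h1, h2⟩
  · exact ⟨fun h => absurd h h2, fun h => absurd h h1⟩
  · rw [h1, h2]
    obtain ⟨-, hmono, -⟩ := strictAntiOn_strictMonoOn_strictAntiOn hP hQ hf hx hy hc hxm hym hc0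
      hu hw hum hwm
    have hwu : -w < -u := by linarith [hu.2, hw.1]
    refine ⟨fun h => (hmono (left_mem_Icc.2 hwu.le) (right_mem_Icc.2 hwu.le) hwu).trans h,
      fun h h' => ⟨(hnear _ ?_).trans_lt h, fun h3 => h' ((hfar _ ?_).trans_lt h3)⟩⟩
    · constructor <;> linarith [hy.1, hy.2, hw.1, hw.2, hc.1]
    · constructor <;> linarith [hy.1, hy.2, hu.1, hu.2, hc.2]

include hb hba hr hp hq in
lemma mem_twoPointCenters_iff (hoff : (p, q) ∉ offsetImage a b r) :
    (p, q) ∈ twoPointCenters a b r ↔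
      ((p, q) ∈ normalMap a b '' nearRegion a b r ∧
        (p, q) ∉ normalMap (-a) (-b) '' farRegion a b r) ∧
      ¬ ((p, q) ∈ normalMap a (-b) '' minRegion a b r ∧
        (p, q) ∉ normalMap a (-b) '' maxRegion a b r) := by
  have ha := hb.trans hba
  have hr0 := ha.trans hr
  have hm : 0 < a ^ 2 - b ^ 2 := sub_pos.2 (pow_lt_pow_left₀ hba hb.le two_ne_zero)
  have hP := mul_pos ha hp
  have hQ := mul_pos hb hq
  have hpi := pi_pos
  have hf := hasDerivAt_sqDist a b p q
  have hper := periodic_sqDist a b p q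
  obtain ⟨x, hx, hxm⟩ := exists_normalEqn_eq hP hQ (a ^ 2 - b ^ 2)
  obtain ⟨y, hy, hym⟩ := exists_normalEqn_eq hP hQ (-(a ^ 2 - b ^ 2))
  obtain ⟨c, hc, hc0⟩ := exists_cubicSlope_eq_zero hP hQ
  have hnear := fun s => apply_nearest_le (s := s) hP hQ hm hf hx hy hxm hym
    fun θ hθ => sqDist_le_sqDist_neg hQ hθ
  have hfar := fun s => apply_le_farthest (s := s) hP hQ hm hf hper hx hy hxm hym
    fun θ hθ => sqDist_neg_le_sqDist_sub_pi hP hθ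
  have hA : -a ≠ 0 := neg_ne_zero.2 ha.ne'
  have hB : -b ≠ 0 := neg_ne_zero.2 hb.ne'
  have hxr : sqDist a b p q x ≠ r ^ 2 := fun h =>
    hoff (Or.inl (Or.inl (mem_image_offsetRegion ha.ne' hb.ne' hx hxm h)))
  have hyr : sqDist a b p q (y - π) ≠ r ^ 2 := fun h => by
    rw [← sqDist_neg_neg] at h
    refine hoff (Or.inl (Or.inr (mem_image_offsetRegion hA hB hy ?_ h)))
    have : normalEqn (-a * p) (-(-b * q)) y = -normalEqn (a * p) (-(b * q)) y := by
      simp only [normalEqn]; ring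
    rw [this, hym]
    ring
  have h4r : ∀ z ∈ Ioo 0 (π / 2), normalEqn (a * p) (b * q) z = a ^ 2 - b ^ 2 →
      sqDist a b p q (-z) ≠ r ^ 2 := fun z hz hzm h => by
    rw [← sqDist_neg_right] at h
    exact hoff (Or.inr (mem_image_offsetRegion ha.ne' hB hz (by simpa using hzm) h))
  have hN : (p, q) ∈ twoPointCenters a b r ↔
      {θ ∈ Ico (y - π) (y + π) | sqDist a b p q θ = r ^ 2}.ncard = 2 := by
    simp only [twoPointCenters, mem_ofPred_eq]
    rw [ncard_sphere_inter_Cset ha.ne' hb.ne' hr0.le p q (y - π),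
      show y - π + 2 * π = y + π by ring]
  rw [hN, mem_image_farRegion_iff hb hba hr hp hq hy hym,
    mem_image_nearRegion_iff hb hba hr hp hq hx hxm]
  by_cases h1 : sqDist a b p q x < r ^ 2
  swap
  · have hempty : {θ ∈ Ico (y - π) (y + π) | sqDist a b p q θ = r ^ 2} = ∅ :=
      eq_empty_of_forall_notMem fun θ hθ => h1 (lt_of_le_of_ne
        (hθ.2 ▸ hnear θ (Ico_subset_Icc_self hθ.1)) hxr)
    rw [hempty, ncard_empty]
    simp [h1]
  by_cases h2 : sqDist a b p q (y - π) < r ^ 2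
  · have hempty : {θ ∈ Ico (y - π) (y + π) | sqDist a b p q θ = r ^ 2} = ∅ :=
      eq_empty_of_forall_notMem fun θ hθ => h2.not_ge
        (hθ.2 ▸ hfar θ (Ico_subset_Icc_self hθ.1))
    rw [hempty, ncard_empty]
    simp [h2]
  have h2' : r ^ 2 < sqDist a b p q (y - π) := lt_of_le_of_ne (not_lt.1 h2) hyr.symm
  simp only [h1, h2, not_false_eq_true, and_self, true_and]
  rcases mem_image_minRegion_maxRegion hb hba hr hp hq hc hc0 with
    ⟨h3, h4, h5⟩ | ⟨u, hu, w, hw, hum, hwm, h4, h5⟩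
  · simp only [h4, false_and, not_false_eq_true, iff_true]
    exact ncard_eq_two_of_le_normalEqn hP hQ hm hf hper hx hy hc hxm hym hc0 h1 h2' h3
  · have hu0 := h4r u ⟨hu.1, hu.2.trans hc.2⟩ hum
    have hw0 := h4r w ⟨hc.1.trans hw.1, hw.2⟩ hwm
    rw [ncard_eq_two_iff_of_normalEqn_eq hP hQ hm hf hper hx hy hc hxm hym hc0 h1 h2' hu hw hum hwm
      hu0 hw0, h4, h5, not_lt, le_iff_lt_or_eq, or_iff_left hu0.symm]

end Quadrant

lemma continuous_speed (a b : ℝ) : Continuous (speed a b) := by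
  unfold speed; fun_prop

/-- The derivative of `normalMap A B`. -/
def normalMapDeriv (A B : ℝ) (z : ℝ × ℝ) : ℝ × ℝ →L[ℝ] ℝ × ℝ :=
  (Matrix.toLin (.finTwoProd ℝ) (.finTwoProd ℝ)
    !![-(sin z.1 * A * (1 + z.2 * (A * B) / speed A B z.1 ^ 3)), cos z.1 * B / speed A B z.1;
      cos z.1 * B * (1 + z.2 * (A * B) / speed A B z.1 ^ 3),
      sin z.1 * A / speed A B z.1]).toContinuousLinearMap

lemma hasDerivAt_speed {A B : ℝ} (hA : A ≠ 0) (hB : B ≠ 0) (x : ℝ) :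
    HasDerivAt (speed A B) ((A ^ 2 - B ^ 2) * (sin x * cos x) / speed A B x) x := by
  have h : HasDerivAt (fun x => A ^ 2 * sin x ^ 2 + B ^ 2 * cos x ^ 2)
      (2 * ((A ^ 2 - B ^ 2) * (sin x * cos x))) x := by
    convert! (((hasDerivAt_sin x).pow 2).const_mul (A ^ 2)).add
      (((hasDerivAt_cos x).pow 2).const_mul (B ^ 2)) using 1
    ring
  convert! h.sqrt (speed_arg_pos hA hB x).ne' using 1
  rw [mul_div_mul_left _ _ two_ne_zero, speed]

lemma hasDerivAt_cos_div_speed {A B : ℝ} (hA : A ≠ 0) (hB : B ≠ 0) (x : ℝ) :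
    HasDerivAt (fun x => cos x / speed A B x) (-(A ^ 2 * sin x / speed A B x ^ 3)) x := by
  have hw := (speed_pos hA hB x).ne'
  convert! (hasDerivAt_cos x).div (hasDerivAt_speed hA hB x) hw using 1
  field_simp
  rw [speed_sq]
  linear_combination (A ^ 2 * sin x) * sin_sq_add_cos_sq x

lemma hasDerivAt_sin_div_speed {A B : ℝ} (hA : A ≠ 0) (hB : B ≠ 0) (x : ℝ) :
    HasDerivAt (fun x => sin x / speed A B x) (B ^ 2 * cos x / speed A B x ^ 3) x := by
  have hw := (speed_pos hA hB x).ne'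
  convert! (hasDerivAt_sin x).div (hasDerivAt_speed hA hB x) hw using 1
  field_simp
  rw [speed_sq]
  linear_combination (-(B ^ 2) * cos x) * sin_sq_add_cos_sq x

lemma hasFDerivAt_normalMap {A B : ℝ} (hA : A ≠ 0) (hB : B ≠ 0) (z : ℝ × ℝ) :
    HasFDerivAt (normalMap A B) (normalMapDeriv A B z) z := by
  have hw := (speed_pos hA hB z.1).ne'
  have hfun : normalMap A B = fun z => (A * cos z.1 + B * (z.2 * (cos z.1 / speed A B z.1)),
      B * sin z.1 + A * (z.2 * (sin z.1 / speed A B z.1))) := by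
    funext z
    simp only [normalMap]
    ext <;> ring
  rw [hfun, normalMapDeriv, Matrix.toLin_finTwoProd_toContinuousLinearMap]
  convert! HasFDerivAt.prodMk (𝕜 := ℝ)
    ((((hasDerivAt_cos z.1).comp_hasFDerivAt z hasFDerivAt_fst).const_mul A).add
      ((hasFDerivAt_snd.mul ((hasDerivAt_cos_div_speed hA hB z.1).comp_hasFDerivAt z
        hasFDerivAt_fst)).const_mul B))
    ((((hasDerivAt_sin z.1).comp_hasFDerivAt z hasFDerivAt_fst).const_mul B).add
      ((hasFDerivAt_snd.mul ((hasDerivAt_sin_div_speed hA hB z.1).comp_hasFDerivAt z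
        hasFDerivAt_fst)).const_mul A)) using 1
  ext <;> simp <;> ring

lemma det_normalMapDeriv {A B : ℝ} (hA : A ≠ 0) (hB : B ≠ 0) (z : ℝ × ℝ) :
    (normalMapDeriv A B z).det =
      -(speed A B z.1 + z.2 * (A * B / speed A B z.1 ^ 2)) := by
  have hw := (speed_pos hA hB z.1).ne'
  have h2 := speed_sq A B z.1
  simp only [normalMapDeriv, LinearMap.det_toContinuousLinearMap, LinearMap.det_toLin,
    Matrix.det_fin_two_of]
  field_simp
  linear_combination (speed A B z.1 ^ 3 + z.2 * A * B) * h2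

lemma volume_image_offsetRegion {A B : ℝ} (hA : A ≠ 0) (hB : B ≠ 0) (r : ℝ) :
    volume (normalMap A B '' offsetRegion r) = 0 := by
  refine addHaar_image_eq_zero_of_differentiableOn_of_addHaar_eq_zero volume
    (fun z _ => (hasFDerivAt_normalMap hA hB z).differentiableAt.differentiableWithinAt) ?_
  refine measure_mono_null (t := univ ×ˢ {r, -r}) (fun z hz => ⟨mem_univ _, ?_⟩) ?_
  · simpa using sq_eq_sq_iff_eq_or_eq_neg.1 hz.2
  · rw [Measure.volume_eq_prod, Measure.prod_prod]
    simp [Set.Finite.measure_zero]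

lemma volume_offsetImage {a b : ℝ} (ha : a ≠ 0) (hb : b ≠ 0) (r : ℝ) :
    volume (offsetImage a b r) = 0 := by
  have hA : -a ≠ 0 := neg_ne_zero.2 ha
  have hB : -b ≠ 0 := neg_ne_zero.2 hb
  simp only [offsetImage, measure_union_null_iff, volume_image_offsetRegion ha hb,
    volume_image_offsetRegion hA hB, volume_image_offsetRegion ha hB, and_self]

lemma lintegral_Ioo_ofReal_affine {c k l u : ℝ} (h : ∀ t ∈ Ioo l u, 0 ≤ c + t * k) :
    ∫⁻ t in Ioo l u, ENNReal.ofReal (c + t * k) =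
      ENNReal.ofReal (c * max l u + max l u ^ 2 * k / 2 - (c * l + l ^ 2 * k / 2)) := by
  rcases le_or_gt u l with hlu | hlu
  · simp [max_eq_left hlu, Ioo_eq_empty_of_le hlu]
  have hd : ∀ t, HasDerivAt (fun t => c * t + t ^ 2 * k / 2) (c + t * k) t := fun t => by
    convert! ((hasDerivAt_id t).const_mul c).add
      ((((hasDerivAt_id t).pow 2).mul_const k).div_const 2)
      using 1
    simp
    ring
  have hc : Continuous fun t : ℝ => c + t * k := by fun_prop
  rw [max_eq_right hlu.le, ← intervalIntegral.integral_eq_sub_of_hasDerivAt (fun t _ => hd t)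
    (hc.intervalIntegrable _ _), intervalIntegral.integral_of_le hlu.le,
    integral_Ioc_eq_integral_Ioo, ofReal_integral_eq_lintegral_ofReal]
  · exact (hc.integrableOn_Icc).mono_set Ioo_subset_Icc_self
  · exact (ae_restrict_iff' measurableSet_Ioo).2 (ae_of_all _ h)

/-- An antiderivative in `t` of the Jacobian of the normal coordinates. -/
def stripArea (A B x t : ℝ) : ℝ := speed A B x * t + t ^ 2 * (A * B / speed A B x ^ 2) / 2

lemma measurableSet_strip {l u : ℝ → ℝ} (hl : Continuous l) (hu : Continuous u) :
    MeasurableSet {z : ℝ × ℝ | z.1 ∈ Ioo 0 (π / 2) ∧ z.2 ∈ Ioo (l z.1) (u z.1)} := by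
  refine (measurableSet_Ioo.preimage measurable_fst).inter
    ((measurableSet_lt (hl.measurable.comp measurable_fst) measurable_snd).inter
      (measurableSet_lt measurable_snd (hu.measurable.comp measurable_fst)))

lemma continuous_stripArea {A B : ℝ} (hA : A ≠ 0) (hB : B ≠ 0) {u : ℝ → ℝ} (hu : Continuous u) :
    Continuous fun x => stripArea A B x (u x) := by
  have h := continuous_speed A B
  have h0 : ∀ x, speed A B x ^ 2 ≠ 0 := fun x => pow_ne_zero 2 (speed_pos hA hB x).ne'
  unfold stripArea
  fun_prop (disch := exact h0 _)

lemma volume_image_strip {A B σ : ℝ} (hA : A ≠ 0) (hB : B ≠ 0) (hσ : |σ| = 1) {l u : ℝ → ℝ}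
    (hl : Continuous l) (hu : Continuous u)
    (hinj : InjOn (normalMap A B) {z | z.1 ∈ Ioo 0 (π / 2) ∧ z.2 ∈ Ioo (l z.1) (u z.1)})
    (hsign : ∀ x, ∀ t ∈ Ioo (l x) (u x), 0 ≤ σ * (speed A B x + t * (A * B / speed A B x ^ 2))) :
    volume (normalMap A B '' {z | z.1 ∈ Ioo 0 (π / 2) ∧ z.2 ∈ Ioo (l z.1) (u z.1)}) =
        ENNReal.ofReal (∫ x in 0..(π / 2),
          σ * (stripArea A B x (max (l x) (u x)) - stripArea A B x (l x))) ∧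
      0 ≤ ∫ x in 0..(π / 2),
          σ * (stripArea A B x (max (l x) (u x)) - stripArea A B x (l x)) := by
  have hS := measurableSet_strip hl hu
  set S := {z : ℝ × ℝ | z.1 ∈ Ioo 0 (π / 2) ∧ z.2 ∈ Ioo (l z.1) (u z.1)} with hSdef
  have hpi : (0 : ℝ) ≤ π / 2 := by positivity
  set g : ℝ → ℝ := fun x => σ * (stripArea A B x (max (l x) (u x)) - stripArea A B x (l x)) with hg
  have hgc : Continuous g := continuous_const.mul
    ((continuous_stripArea hA hB (hl.max hu)).sub (continuous_stripArea hA hB hl))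
  have hinner : ∀ x, ∫⁻ t in Ioo (l x) (u x),
      ENNReal.ofReal (σ * (speed A B x + t * (A * B / speed A B x ^ 2))) =
        ENNReal.ofReal (g x) := fun x => by
    have h1 : ∀ t, σ * (speed A B x + t * (A * B / speed A B x ^ 2)) =
      σ * speed A B x + t * (σ * (A * B / speed A B x ^ 2)) := fun t => by ring
    have h2 := hsign x
    simp only [h1] at h2 ⊢
    rw [lintegral_Ioo_ofReal_affine h2]
    simp only [hg, stripArea]
    congr 1
    ring
  have hg0 : ∀ x, 0 ≤ g x := fun x => by
    rcases le_or_gt (u x) (l x) with h | h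
    · simp [hg, max_eq_left h]
    · have hd : ∀ t, HasDerivAt (fun t => σ * stripArea A B x t)
          (σ * (speed A B x + t * (A * B / speed A B x ^ 2))) t := fun t => by
        refine HasDerivAt.const_mul σ ?_
        convert! ((hasDerivAt_id t).const_mul (speed A B x)).add
          ((((hasDerivAt_id t).pow 2).mul_const (A * B / speed A B x ^ 2)).div_const 2) using 1
        simp
        ring
      have := monotoneOn_of_deriv_nonneg (convex_Icc (l x) (u x))
        (fun t _ => (hd t).continuousAt.continuousWithinAt)
        (fun t _ => (hd t).differentiableAt.differentiableWithinAt)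
        (fun t ht => by rw [(hd t).deriv]; exact hsign x t (by rwa [interior_Icc] at ht))
        (left_mem_Icc.2 h.le) (right_mem_Icc.2 h.le) h.le
      simp only at this
      simp only [hg, max_eq_right h.le]
      linarith
  refine ⟨?_, intervalIntegral.integral_nonneg hpi fun x _ => hg0 x⟩
  rw [← lintegral_abs_det_fderiv_eq_addHaar_image volume hS
    (fun z _ => (hasFDerivAt_normalMap hA hB z).hasFDerivWithinAt) hinj]
  have hF : Measurable fun z : ℝ × ℝ =>
      ENNReal.ofReal (σ * (speed A B z.1 + z.2 * (A * B / speed A B z.1 ^ 2))) := by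
    have := (continuous_speed A B).measurable
    fun_prop
  have h1 : ∫⁻ z in S, ENNReal.ofReal |(normalMapDeriv A B z).det| =
      ∫⁻ z in S, ENNReal.ofReal (σ * (speed A B z.1 + z.2 * (A * B / speed A B z.1 ^ 2))) := by
    refine setLIntegral_congr_fun hS fun z hz => ?_
    simp only [det_normalMapDeriv hA hB, abs_neg]
    rw [← abs_of_nonneg (hsign z.1 z.2 hz.2), abs_mul, hσ, one_mul]
  rw [h1, ← lintegral_indicator hS, Measure.volume_eq_prod,
    lintegral_prod _ (hF.indicator hS).aemeasurable, intervalIntegral.integral_of_le hpi,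
    integral_Ioc_eq_integral_Ioo, ofReal_integral_eq_lintegral_ofReal
      (hgc.integrableOn_Icc.mono_set Ioo_subset_Icc_self) (ae_of_all _ hg0),
    ← lintegral_indicator measurableSet_Ioo]
  refine lintegral_congr fun x => ?_
  by_cases hx : x ∈ Ioo 0 (π / 2)
  · rw [indicator_of_mem hx, ← hinner x, ← lintegral_indicator measurableSet_Ioo]
    refine lintegral_congr fun t => ?_
    simp only [indicator, hSdef, mem_ofPred_eq, hx, true_and]
  · rw [indicator_of_notMem hx]
    simp only [indicator, hSdef, mem_ofPred_eq, hx, false_and, if_false, lintegral_zero]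

lemma measurableSet_image_strip {A B : ℝ} (hA : A ≠ 0) (hB : B ≠ 0) {l u : ℝ → ℝ}
    (hl : Continuous l) (hu : Continuous u)
    (hinj : InjOn (normalMap A B) {z | z.1 ∈ Ioo 0 (π / 2) ∧ z.2 ∈ Ioo (l z.1) (u z.1)}) :
    MeasurableSet (normalMap A B '' {z | z.1 ∈ Ioo 0 (π / 2) ∧ z.2 ∈ Ioo (l z.1) (u z.1)}) :=
  measurable_image_of_fderivWithin (measurableSet_strip hl hu)
    (fun z _ => (hasFDerivAt_normalMap hA hB z).hasFDerivWithinAt) hinj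

lemma eq_of_normalMap_eq {A B x s t : ℝ} (hA : A ≠ 0) (hB : B ≠ 0) (hx : x ∈ Ioo 0 (π / 2))
    (h : normalMap A B (x, s) = normalMap A B (x, t)) : s = t := by
  have hw := (speed_pos hA hB x).ne'
  have h1 := mul_left_cancel₀ (cos_pos_of_mem_quadrant hx).ne' (Prod.mk.inj h).1
  have h2 : s * B / speed A B x = t * B / speed A B x := add_left_cancel h1
  exact mul_right_cancel₀ hB ((div_left_inj' hw).1 h2)

/-- The open first quadrant. -/
def quadrant : Set (ℝ × ℝ) := Ioi 0 ×ˢ Ioi 0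

lemma normalMap_mem_quadrant {A B x t : ℝ} (hA : A ≠ 0) (hB : B ≠ 0) (hx : x ∈ Ioo 0 (π / 2))
    (h1 : 0 < A * speed A B x + t * B) (h2 : 0 < B * speed A B x + t * A) :
    normalMap A B (x, t) ∈ quadrant :=
  have h := normalMap_pos_iff hA hB hx (Prod.mk.eta (p := normalMap A B (x, t))).symm
  ⟨h.1.2 h1, h.2.2 h2⟩

section Injectivity

variable {a b r : ℝ} (hb : 0 < b) (hba : b < a)

include hb hba

lemma image_nearRegion_subset : normalMap a b '' nearRegion a b r ⊆ quadrant := by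
  rintro _ ⟨⟨x, t⟩, ⟨hx, ht1, -⟩, rfl⟩
  have ha := hb.trans hba
  have hw := speed_pos ha.ne' hb.ne' x
  simp only [← neg_div, div_lt_iff₀ ha] at ht1
  refine normalMap_mem_quadrant ha.ne' hb.ne' hx ?_ (by linarith)
  nlinarith [mul_pos hw (sub_pos.2 hba)]

lemma image_farRegion_subset : normalMap (-a) (-b) '' farRegion a b r ⊆ quadrant := by
  rintro _ ⟨⟨x, t⟩, ⟨hx, -, ht2⟩, rfl⟩
  have ha := hb.trans hba
  have hw := speed_pos ha.ne' hb.ne' x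
  simp only [lt_neg, div_lt_iff₀ hb] at ht2
  refine normalMap_mem_quadrant (neg_ne_zero.2 ha.ne') (neg_ne_zero.2 hb.ne') hx ?_ ?_ <;>
    simp only [speed_neg_left, speed_neg_right]
  · linarith
  · nlinarith [mul_pos hw (sub_pos.2 hba)]

lemma image_minRegion_subset : normalMap a (-b) '' minRegion a b r ⊆ quadrant := by
  rintro _ ⟨⟨x, t⟩, ⟨hx, ht1, ht2⟩, rfl⟩
  have ha := hb.trans hba
  have ht := ((lt_min_iff.1 ht2).2.trans_le (pow_speed_div_le hb hba x))
  simp only [lt_div_iff₀ hb, div_lt_iff₀ ha] at ht ht1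
  refine normalMap_mem_quadrant ha.ne' (neg_ne_zero.2 hb.ne') hx ?_ ?_ <;>
    simp only [speed_neg_right] <;> linarith

lemma image_maxRegion_subset : normalMap a (-b) '' maxRegion a b r ⊆ quadrant := by
  rintro _ ⟨⟨x, t⟩, ⟨hx, ht1, ht2⟩, rfl⟩
  have ha := hb.trans hba
  have ht := (lt_min_iff.1 ht2).2
  have ht' := (mul_speed_div_le_pow hb hba x).trans_lt ht1
  simp only [lt_div_iff₀ hb, div_lt_iff₀ ha] at ht ht'
  refine normalMap_mem_quadrant ha.ne' (neg_ne_zero.2 hb.ne') hx ?_ ?_ <;>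
    simp only [speed_neg_right] <;> linarith

lemma injOn_nearRegion : InjOn (normalMap a b) (nearRegion a b r) := by
  rintro ⟨x, t⟩ hz ⟨y, s⟩ hz' h
  have ha := hb.trans hba
  obtain ⟨hp, hq⟩ := image_nearRegion_subset hb hba ⟨_, hz, rfl⟩
  have h1 := normalEqn_of_normalMap_eq ha.ne' hb.ne' hz.1
    (Prod.mk.eta (p := normalMap a b (x, t))).symm
  have h2 := normalEqn_of_normalMap_eq ha.ne' hb.ne' hz'.1 (h.symm.trans Prod.mk.eta.symm)
  obtain rfl : x = y := (normalEqn_strictMonoOn (mul_pos ha hp) (mul_pos hb hq)).injOn hz.1 hz'.1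
    (h1.trans h2.symm)
  rw [eq_of_normalMap_eq ha.ne' hb.ne' hz.1 h]

lemma injOn_farRegion : InjOn (normalMap (-a) (-b)) (farRegion a b r) := by
  rintro ⟨x, t⟩ hz ⟨y, s⟩ hz' h
  have ha := hb.trans hba
  have hA := neg_ne_zero.2 ha.ne'
  have hB := neg_ne_zero.2 hb.ne'
  obtain ⟨hp, hq⟩ := image_farRegion_subset hb hba ⟨_, hz, rfl⟩
  have h1 := normalEqn_of_normalMap_eq hA hB hz.1
    (Prod.mk.eta (p := normalMap (-a) (-b) (x, t))).symm
  have h2 := normalEqn_of_normalMap_eq hA hB hz'.1 (h.symm.trans Prod.mk.eta.symm)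
  have h3 := h1.trans h2.symm
  obtain rfl : x = y := by
    refine (normalEqn_strictMonoOn (mul_pos ha hp) (mul_pos hb hq)).injOn hz.1 hz'.1 ?_
    simp only [normalEqn, neg_mul, neg_neg, neg_div] at h3 ⊢
    linarith
  rw [eq_of_normalMap_eq hA hB hz.1 h]

lemma injOn_minRegion : InjOn (normalMap a (-b)) (minRegion a b r) := by
  have ha := hb.trans hba
  have hB := neg_ne_zero.2 hb.ne'
  have hslope : ∀ x t, (x, t) ∈ minRegion a b r → ∀ p q, normalMap a (-b) (x, t) = (p, q) →
      0 ≤ cubicSlope (a * p) (b * q) x := by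
    intro x t hz p q h
    have hk := cubicSlope_of_normalMap_eq ha.ne' hB h
    simp only [neg_mul, neg_neg, speed_neg_right] at hk
    have hw := speed_pos ha.ne' hb.ne' x
    have ht := (lt_div_iff₀ (mul_pos ha hb)).1 (lt_min_iff.1 hz.2.2).2
    simp only at ht
    have := sin_pos_of_mem_quadrant hz.1
    have := cos_pos_of_mem_quadrant hz.1
    rw [hk]
    exact div_nonneg (mul_nonneg (by positivity) (by linarith)) hw.le
  rintro ⟨x, t⟩ hz ⟨y, s⟩ hz' h
  obtain ⟨hp, hq⟩ := image_minRegion_subset hb hba ⟨_, hz, rfl⟩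
  have h1 := normalEqn_of_normalMap_eq ha.ne' hB hz.1
    (Prod.mk.eta (p := normalMap a (-b) (x, t))).symm
  have h2 := normalEqn_of_normalMap_eq ha.ne' hB hz'.1 (h.symm.trans Prod.mk.eta.symm)
  have h3 := h1.trans h2.symm
  simp only [neg_mul, neg_neg] at h3
  obtain rfl : x = y := by
    rcases lt_trichotomy x y with h4 | h4 | h4
    · exact absurd h3 (normalEqn_lt_of_cubicSlope_nonneg (mul_pos ha hp) (mul_pos hb hq) hz.1 hz'.1
        h4 (hslope x t hz _ _ Prod.mk.eta.symm)).ne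
    · exact h4
    · exact absurd h3 (normalEqn_lt_of_cubicSlope_nonneg (mul_pos ha hp) (mul_pos hb hq) hz'.1 hz.1
        h4 (hslope y s hz' _ _ (h.symm.trans Prod.mk.eta.symm))).ne'
  rw [eq_of_normalMap_eq ha.ne' hB hz.1 h]

lemma injOn_maxRegion : InjOn (normalMap a (-b)) (maxRegion a b r) := by
  have ha := hb.trans hba
  have hB := neg_ne_zero.2 hb.ne'
  have hslope : ∀ x t, (x, t) ∈ maxRegion a b r → ∀ p q, normalMap a (-b) (x, t) = (p, q) →
      cubicSlope (a * p) (b * q) x ≤ 0 := by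
    intro x t hz p q h
    have hk := cubicSlope_of_normalMap_eq ha.ne' hB h
    simp only [neg_mul, neg_neg, speed_neg_right] at hk
    have hw := speed_pos ha.ne' hb.ne' x
    have ht := (div_lt_iff₀ (mul_pos ha hb)).1 hz.2.1
    simp only at ht
    have := sin_pos_of_mem_quadrant hz.1
    have := cos_pos_of_mem_quadrant hz.1
    rw [hk]
    exact div_nonpos_of_nonpos_of_nonneg
      (mul_nonpos_of_nonneg_of_nonpos (by positivity) (by linarith)) hw.le
  rintro ⟨x, t⟩ hz ⟨y, s⟩ hz' h
  obtain ⟨hp, hq⟩ := image_maxRegion_subset hb hba ⟨_, hz, rfl⟩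
  have h1 := normalEqn_of_normalMap_eq ha.ne' hB hz.1
    (Prod.mk.eta (p := normalMap a (-b) (x, t))).symm
  have h2 := normalEqn_of_normalMap_eq ha.ne' hB hz'.1 (h.symm.trans Prod.mk.eta.symm)
  have h3 := h1.trans h2.symm
  simp only [neg_mul, neg_neg] at h3
  obtain rfl : x = y := by
    rcases lt_trichotomy x y with h4 | h4 | h4
    · exact absurd h3 (normalEqn_lt_of_cubicSlope_nonpos (mul_pos ha hp) (mul_pos hb hq) hz.1 hz'.1
        h4 (hslope y s hz' _ _ (h.symm.trans Prod.mk.eta.symm))).ne'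
    · exact h4
    · exact absurd h3 (normalEqn_lt_of_cubicSlope_nonpos (mul_pos ha hp) (mul_pos hb hq) hz'.1 hz.1
        h4 (hslope x t hz _ _ Prod.mk.eta.symm)).ne
  rw [eq_of_normalMap_eq ha.ne' hB hz.1 h]

end Injectivity

section Volume

variable {a b r : ℝ} (hb : 0 < b) (hba : b < a) (hr : a < r)

/-- The combination of strip areas whose integral is the area of `twoPointCenters` in the
quadrant. -/
def quarterIntegrand (a b r x : ℝ) : ℝ :=
  (stripArea a b x r - stripArea a b x (-(b * speed a b x / a))) -
    (stripArea a (-b) x (min r (a * speed a b x / b)) - stripArea a (-b) x r) -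
    (stripArea a (-b) x (min r (a * speed a b x / b)) - stripArea a (-b) x (b * speed a b x / a))

include hb hba

include hr in
lemma volume_image_nearRegion :
    volume (normalMap a b '' nearRegion a b r) =
        ENNReal.ofReal (∫ x in 0..(π / 2),
          (stripArea a b x r - stripArea a b x (-(b * speed a b x / a)))) ∧
      0 ≤ ∫ x in 0..(π / 2), (stripArea a b x r - stripArea a b x (-(b * speed a b x / a))) := by
  have ha := hb.trans hba
  have hc := continuous_speed a b
  have h := volume_image_strip (σ := 1) (l := fun x => -(b * speed a b x / a)) (u := fun _ => r)
    ha.ne' hb.ne' abs_one (by fun_prop) continuous_const (injOn_nearRegion hb hba) ?_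
  · have hmax : ∀ x, max (-(b * speed a b x / a)) r = r := fun x => max_eq_right <| by
      have := div_nonneg (mul_nonneg hb.le (speed_pos ha.ne' hb.ne' x).le) ha.le
      linarith
    simp only [one_mul, hmax] at h
    exact h
  · intro x t ht
    have hw := speed_pos ha.ne' hb.ne' x
    have h1 := le_speed hb hba x
    have h2 : -(b * speed a b x / a) * (a * b / speed a b x ^ 2) = -(b ^ 2 / speed a b x) := by
      field_simp
    have h3 := mul_lt_mul_of_pos_right ht.1
      (show 0 < a * b / speed a b x ^ 2 by have := mul_pos ha hb; positivity)
    have h4 : b ^ 2 / speed a b x ≤ speed a b x := by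
      rw [div_le_iff₀ hw]
      nlinarith
    simp only [h2] at h3
    linarith

lemma volume_image_farRegion :
    volume (normalMap (-a) (-b) '' farRegion a b r) =
        ENNReal.ofReal (∫ x in 0..(π / 2),
          (stripArea a (-b) x (min r (a * speed a b x / b)) - stripArea a (-b) x r)) ∧
      0 ≤ ∫ x in 0..(π / 2),
        (stripArea a (-b) x (min r (a * speed a b x / b)) - stripArea a (-b) x r) := by
  have ha := hb.trans hba
  have hc := continuous_speed a b
  have h := volume_image_strip (σ := -1) (l := fun _ => -r) (u := fun x => -(a * speed a b x / b))
    (neg_ne_zero.2 ha.ne') (neg_ne_zero.2 hb.ne') (by simp) continuous_const (by fun_prop)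
    (injOn_farRegion hb hba) ?_
  · have hkey : ∀ x, -1 * (stripArea (-a) (-b) x (max (-r) (-(a * speed a b x / b))) -
        stripArea (-a) (-b) x (-r)) =
        stripArea a (-b) x (min r (a * speed a b x / b)) - stripArea a (-b) x r := fun x => by
      rw [max_neg_neg]
      simp only [stripArea, speed_neg_left, speed_neg_right]
      ring
    simp only [hkey] at h
    exact h
  · intro x t ht
    have hw := speed_pos ha.ne' hb.ne' x
    have h1 := speed_le hb hba x
    have h2 : -(a * speed a b x / b) * (a * b / speed a b x ^ 2) = -(a ^ 2 / speed a b x) := by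
      field_simp
    have h3 := mul_lt_mul_of_pos_right ht.2
      (show 0 < a * b / speed a b x ^ 2 by have := mul_pos ha hb; positivity)
    have h4 : speed a b x ≤ a ^ 2 / speed a b x := by
      rw [le_div_iff₀ hw]
      nlinarith
    simp only [h2] at h3
    simp only [speed_neg_left, speed_neg_right, neg_mul_neg]
    linarith

include hr in
lemma volume_image_minRegion :
    volume (normalMap a (-b) '' minRegion a b r) =
        ENNReal.ofReal (∫ x in 0..(π / 2),
          (stripArea a (-b) x (min r (speed a b x ^ 3 / (a * b))) -
            stripArea a (-b) x (b * speed a b x / a))) ∧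
      0 ≤ ∫ x in 0..(π / 2),
          (stripArea a (-b) x (min r (speed a b x ^ 3 / (a * b))) -
            stripArea a (-b) x (b * speed a b x / a)) := by
  have ha := hb.trans hba
  have hc := continuous_speed a b
  have h := volume_image_strip (σ := 1) (l := fun x => b * speed a b x / a)
    (u := fun x => min r (speed a b x ^ 3 / (a * b)))
    ha.ne' (neg_ne_zero.2 hb.ne') abs_one (by fun_prop) (by fun_prop) (injOn_minRegion hb hba) ?_
  · have hmax : ∀ x, max (b * speed a b x / a) (min r (speed a b x ^ 3 / (a * b))) =
        min r (speed a b x ^ 3 / (a * b)) := fun x => max_eq_right <|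
      le_min (mul_speed_div_lt hb hba hr x).le (mul_speed_div_le_pow hb hba x)
    simp only [one_mul, hmax] at h
    exact h
  · intro x t ht
    have hw := speed_pos ha.ne' hb.ne' x
    have h2 : speed a b x ^ 3 / (a * b) * (a * b / speed a b x ^ 2) = speed a b x := by
      field_simp
    have h3 := mul_lt_mul_of_pos_right (lt_min_iff.1 ht.2).2
      (show 0 < a * b / speed a b x ^ 2 by have := mul_pos ha hb; positivity)
    rw [h2] at h3
    simp only [speed_neg_right, mul_neg, neg_div]
    linarith

lemma volume_image_maxRegion :
    volume (normalMap a (-b) '' maxRegion a b r) =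
        ENNReal.ofReal (∫ x in 0..(π / 2),
          (stripArea a (-b) x (min r (speed a b x ^ 3 / (a * b))) -
            stripArea a (-b) x (min r (a * speed a b x / b)))) ∧
      0 ≤ ∫ x in 0..(π / 2),
          (stripArea a (-b) x (min r (speed a b x ^ 3 / (a * b))) -
            stripArea a (-b) x (min r (a * speed a b x / b))) := by
  have ha := hb.trans hba
  have hc := continuous_speed a b
  have h := volume_image_strip (σ := -1) (l := fun x => speed a b x ^ 3 / (a * b))
    (u := fun x => min r (a * speed a b x / b))
    ha.ne' (neg_ne_zero.2 hb.ne') (by simp) (by fun_prop) (by fun_prop) (injOn_maxRegion hb hba) ?_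
  · have hmax : ∀ x, -1 * (stripArea a (-b) x
          (max (speed a b x ^ 3 / (a * b)) (min r (a * speed a b x / b))) -
          stripArea a (-b) x (speed a b x ^ 3 / (a * b))) =
        stripArea a (-b) x (min r (speed a b x ^ 3 / (a * b))) -
          stripArea a (-b) x (min r (a * speed a b x / b)) := fun x => by
      have h1 := pow_speed_div_le hb hba x
      rcases le_total r (speed a b x ^ 3 / (a * b)) with h2 | h2
      · rw [min_eq_left h2, min_eq_left (h2.trans h1), max_eq_left h2]
        ring
      · rw [min_eq_right h2, max_eq_right (le_min h2 h1)]
        ring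
    simp only [hmax] at h
    exact h
  · intro x t ht
    have hw := speed_pos ha.ne' hb.ne' x
    have h2 : speed a b x ^ 3 / (a * b) * (a * b / speed a b x ^ 2) = speed a b x := by
      field_simp
    have h3 := mul_lt_mul_of_pos_right ht.1
      (show 0 < a * b / speed a b x ^ 2 by have := mul_pos ha hb; positivity)
    rw [h2] at h3
    simp only [speed_neg_right, mul_neg, neg_div]
    linarith

include hr in
lemma volume_twoPointCenters_inter_quadrant :
    volume (twoPointCenters a b r ∩ quadrant) =
      ENNReal.ofReal (∫ x in 0..(π / 2), quarterIntegrand a b r x) := by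
  have ha := hb.trans hba
  have hB := neg_ne_zero.2 hb.ne'
  have hc := continuous_speed a b
  obtain ⟨h1, h1'⟩ := volume_image_nearRegion hb hba hr
  obtain ⟨h2, h2'⟩ := volume_image_farRegion (r := r) hb hba
  obtain ⟨h3, h3'⟩ := volume_image_minRegion hb hba hr
  obtain ⟨h4, h4'⟩ := volume_image_maxRegion (r := r) hb hba
  have hm2 : MeasurableSet (normalMap (-a) (-b) '' farRegion a b r) :=
    measurableSet_image_strip (l := fun _ => -r) (u := fun x => -(a * speed a b x / b))
      (neg_ne_zero.2 ha.ne') hB continuous_const (by fun_prop) (injOn_farRegion hb hba)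
  have hm3 : MeasurableSet (normalMap a (-b) '' minRegion a b r) :=
    measurableSet_image_strip (l := fun x => b * speed a b x / a)
      (u := fun x => min r (speed a b x ^ 3 / (a * b))) ha.ne' hB (by fun_prop) (by fun_prop)
      (injOn_minRegion hb hba)
  have hm4 : MeasurableSet (normalMap a (-b) '' maxRegion a b r) :=
    measurableSet_image_strip (l := fun x => speed a b x ^ 3 / (a * b))
      (u := fun x => min r (a * speed a b x / b)) ha.ne' hB (by fun_prop) (by fun_prop)
      (injOn_maxRegion hb hba)
  have hq1 := image_nearRegion_subset hb hba (r := r)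
  have hq2 := image_farRegion_subset hb hba (r := r)
  have hq3 := image_minRegion_subset hb hba (r := r)
  have hq4 := image_maxRegion_subset hb hba (r := r)
  have key : (twoPointCenters a b r ∩ quadrant : Set (ℝ × ℝ)) =ᵐ[volume]
      ((normalMap a b '' nearRegion a b r \ normalMap (-a) (-b) '' farRegion a b r) \
        (normalMap a (-b) '' minRegion a b r \ normalMap a (-b) '' maxRegion a b r) : Set _) := by
    have hoff := measure_eq_zero_iff_ae_notMem.1 (volume_offsetImage ha.ne' hb.ne' r)
    refine Filter.eventuallyEq_set.2 ?_
    filter_upwards [hoff] with z hz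
    by_cases hzq : z ∈ quadrant
    · have := mem_twoPointCenters_iff hb hba hr hzq.1 hzq.2 hz
      exact (and_iff_left hzq).trans this
    · exact iff_of_false (fun h => hzq h.2) fun h => hzq (hq1 h.1.1)
  have hs2 : normalMap (-a) (-b) '' farRegion a b r ⊆ normalMap a b '' nearRegion a b r :=
    fun z hz => (mem_image_region_imp hb hba hr (hq2 hz).1 (hq2 hz).2).1 hz
  have hs4 : normalMap a (-b) '' maxRegion a b r ⊆ normalMap a (-b) '' minRegion a b r :=
    fun z hz => (mem_image_region_imp hb hba hr (hq4 hz).1 (hq4 hz).2).2.1 hz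
  have hs : normalMap a (-b) '' minRegion a b r \ normalMap a (-b) '' maxRegion a b r ⊆
      normalMap a b '' nearRegion a b r \ normalMap (-a) (-b) '' farRegion a b r :=
    fun z hz => (mem_image_region_imp hb hba hr (hq3 hz.1).1 (hq3 hz.1).2).2.2 hz.1 hz.2
  have hd34 : volume (normalMap a (-b) '' minRegion a b r \ normalMap a (-b) '' maxRegion a b r) ≠
      ⊤ :=
    ne_top_of_le_ne_top (by rw [h3]; exact ENNReal.ofReal_ne_top) (measure_mono sdiff_subset)
  have hi : ∀ {B : ℝ}, B ≠ 0 → ∀ {u : ℝ → ℝ}, Continuous u →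
      IntervalIntegrable (fun x => stripArea a B x (u x)) volume 0 (π / 2) :=
    fun hB _ hu => (continuous_stripArea ha.ne' hB hu).intervalIntegrable _ _
  have i1 := hi hb.ne' (continuous_const (y := r))
  have i2 := hi hb.ne' (u := fun x => -(b * speed a b x / a)) (by fun_prop)
  have i3 := hi hB (u := fun x => min r (a * speed a b x / b)) (by fun_prop)
  have i4 := hi hB (continuous_const (y := r))
  have i5 := hi hB (u := fun x => min r (speed a b x ^ 3 / (a * b))) (by fun_prop)
  have i6 := hi hB (u := fun x => b * speed a b x / a) (by fun_prop)
  rw [measure_congr key, measure_sdiff hs (hm3.diff hm4).nullMeasurableSet hd34,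
    measure_sdiff hs2 hm2.nullMeasurableSet (by rw [h2]; exact ENNReal.ofReal_ne_top),
    measure_sdiff hs4 hm4.nullMeasurableSet (by rw [h4]; exact ENNReal.ofReal_ne_top),
    h1, h2, h3, h4,
    ← ENNReal.ofReal_sub _ h2', ← ENNReal.ofReal_sub _ h4', ← ENNReal.ofReal_sub]
  · congr 1
    simp only [quarterIntegrand]
    rw [intervalIntegral.integral_sub ((i1.sub i2).sub (i3.sub i4)) (i3.sub i6),
      intervalIntegral.integral_sub (i1.sub i2) (i3.sub i4),
      intervalIntegral.integral_sub i3 i6, intervalIntegral.integral_sub i5 i6,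
      intervalIntegral.integral_sub i5 i3]
    ring
  · have := measure_mono (μ := volume) hs4
    rw [h3, h4, ENNReal.ofReal_le_ofReal_iff h3'] at this
    exact sub_nonneg.2 this

end Volume

lemma smul_mem_twoPointCenters_iff {a b r σ τ : ℝ} (hr : 0 ≤ r) (hσ : σ ^ 2 = 1) (hτ : τ ^ 2 = 1)
    (z : ℝ × ℝ) : (σ * z.1, τ * z.2) ∈ twoPointCenters a b r ↔ z ∈ twoPointCenters a b r := by
  set f : E2 → E2 := fun w => !₂[σ * w 0, τ * w 1] with hf
  have hinv : Function.Involutive f := fun w => by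
    ext i
    fin_cases i <;> simp [hf, ← mul_assoc, ← sq, hσ, hτ]
  have himage : f '' (sphere (!₂[z.1, z.2] : E2) r ∩ Cset a b) =
      sphere (!₂[σ * z.1, τ * z.2] : E2) r ∩ Cset a b := by
    rw [hinv.image_eq_preimage_symm]
    ext w
    rw [mem_preimage, mem_inter_iff, mem_inter_iff, mem_sphere_iff_sq hr, mem_sphere_iff_sq hr]
    have h1 : (σ * w 0 - z.1) ^ 2 = (w 0 - σ * z.1) ^ 2 := by
      linear_combination (w 0 ^ 2 - z.1 ^ 2) * hσ
    have h2 : (τ * w 1 - z.2) ^ 2 = (w 1 - τ * z.2) ^ 2 := by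
      linear_combination (w 1 ^ 2 - z.2 ^ 2) * hτ
    simp [hf, Cset, h1, h2, mul_pow, hσ, hτ]
  simp only [twoPointCenters, mem_ofPred_eq, ← himage, ncard_image_of_injective _ hinv.injective]

lemma measure_eq_two_mul_of_preimage_eq {α : Type*} [MeasurableSpace α] {μ : Measure α}
    {S H : Set α} (hH : MeasurableSet H) (e : α ≃ᵐ α) (he : MeasurePreserving e μ μ)
    (hS : e ⁻¹' S = S) (heH : e ⁻¹' H =ᵐ[μ] (Hᶜ : Set α)) : μ S = 2 * μ (S ∩ H) := by
  have h : μ (S \ H) = μ (S ∩ H) := by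
    rw [← he.measure_preimage_equiv (S ∩ H), preimage_inter, hS, sdiff_eq]
    exact measure_congr ((Filter.EventuallyEq.refl _ _).inter heH.symm)
  rw [← measure_inter_add_sdiff S hH, h, two_mul]

lemma ae_fst_ne_zero : ∀ᵐ z : ℝ × ℝ, z.1 ≠ 0 := by
  suffices h : volume {z : ℝ × ℝ | z.1 = 0} = 0 from measure_eq_zero_iff_ae_notMem.1 h
  rw [show {z : ℝ × ℝ | z.1 = 0} = {0} ×ˢ univ by ext; simp, Measure.volume_eq_prod,
    Measure.prod_prod]
  simp

lemma ae_snd_ne_zero : ∀ᵐ z : ℝ × ℝ, z.2 ≠ 0 := by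
  suffices h : volume {z : ℝ × ℝ | z.2 = 0} = 0 from measure_eq_zero_iff_ae_notMem.1 h
  rw [show {z : ℝ × ℝ | z.2 = 0} = univ ×ˢ {0} by ext; simp, Measure.volume_eq_prod,
    Measure.prod_prod]
  simp

lemma volume_twoPointCenters {a b r : ℝ} (hr : 0 ≤ r) :
    volume (twoPointCenters a b r) = 4 * volume (twoPointCenters a b r ∩ quadrant) := by
  have hneg : MeasurePreserving (Neg.neg : ℝ → ℝ) volume volume :=
    Measure.measurePreserving_neg volume
  have h1 : volume (twoPointCenters a b r) =
      2 * volume (twoPointCenters a b r ∩ {z | 0 < z.1}) := by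
    refine measure_eq_two_mul_of_preimage_eq (measurableSet_lt measurable_const measurable_fst)
      ((MeasurableEquiv.neg ℝ).prodCongr (.refl ℝ)) (hneg.prod (.id volume)) ?_ ?_
    · ext z
      have := smul_mem_twoPointCenters_iff (a := a) (b := b) (σ := -1) (τ := 1) hr
        (by norm_num) (by norm_num) z
      simp only [one_mul, neg_mul] at this
      exact this
    · refine Filter.eventuallyEq_set.2 (ae_fst_ne_zero.mono fun z hz => ?_)
      change 0 < -z.1 ↔ ¬ 0 < z.1
      rw [neg_pos, not_lt, le_iff_lt_or_eq, or_iff_left hz]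
  have h2 : volume (twoPointCenters a b r ∩ {z | 0 < z.1}) =
      2 * volume (twoPointCenters a b r ∩ {z | 0 < z.1} ∩ {z | 0 < z.2}) := by
    refine measure_eq_two_mul_of_preimage_eq (measurableSet_lt measurable_const measurable_snd)
      ((MeasurableEquiv.refl ℝ).prodCongr (.neg ℝ)) ((MeasurePreserving.id volume).prod hneg) ?_ ?_
    · ext z
      have := smul_mem_twoPointCenters_iff (a := a) (b := b) (σ := 1) (τ := -1) hr
        (by norm_num) (by norm_num) z
      simp only [one_mul, neg_mul] at this
      exact and_congr_left fun _ => this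
    · refine Filter.eventuallyEq_set.2 (ae_snd_ne_zero.mono fun z hz => ?_)
      change 0 < -z.2 ↔ ¬ 0 < z.2
      rw [neg_pos, not_lt, le_iff_lt_or_eq, or_iff_left hz]
  rw [h1, h2, inter_assoc, ← mul_assoc]
  norm_num
  rfl

lemma volume_setOf_ncard_eq (a b r : ℝ) :
    volume {x : E2 | (sphere x r ∩ Cset a b).ncard = 2} = volume (twoPointCenters a b r) := by
  have h1 := EuclideanSpace.volume_preserving_symm_measurableEquiv_toLp (Fin 2)
  have h2 := volume_preserving_finTwoArrow ℝ
  rw [← h2.measure_preimage_equiv, ← h1.measure_preimage_equiv]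
  congr 1
  ext x
  have : (!₂[x 0, x 1] : E2) = x := by
    ext i
    fin_cases i <;> rfl
  change _ ↔ (sphere (!₂[x 0, x 1] : E2) r ∩ Cset a b).ncard = 2
  rw [this]
  rfl

lemma hasDerivAt_arctan_mul_tan {a b x : ℝ} (ha : a ≠ 0) (hb : b ≠ 0) (hx : cos x ≠ 0) :
    HasDerivAt (fun x => arctan (a / b * tan x)) (a * b / speed a b x ^ 2) x := by
  convert! ((hasDerivAt_tan hx).const_mul (a / b)).arctan using 1
  have h := speed_arg_pos ha hb x
  rw [speed_sq, tan_eq_sin_div_cos, show 1 + (a / b * (sin x / cos x)) ^ 2 =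
    (a ^ 2 * sin x ^ 2 + b ^ 2 * cos x ^ 2) / (b ^ 2 * cos x ^ 2) by field_simp; ring]
  field_simp

lemma integral_mul_div_speed_sq {a b φ : ℝ} (ha : a ≠ 0) (hb : b ≠ 0) (hφ : φ ∈ Ico 0 (π / 2)) :
    ∫ x in 0..φ, a * b / speed a b x ^ 2 = arctan (a / b * tan φ) := by
  have hc := continuous_speed a b
  rw [intervalIntegral.integral_eq_sub_of_hasDerivAt
    (fun x hx => hasDerivAt_arctan_mul_tan ha hb ?_)]
  · simp
  · exact (continuous_const.div (hc.pow 2)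
      fun x => pow_ne_zero 2 (speed_pos ha hb x).ne').intervalIntegrable _ _
  · rw [uIcc_of_le hφ.1] at hx
    exact (cos_pos_of_mem_Ioo ⟨by linarith [hx.1, pi_pos], hx.2.trans_lt hφ.2⟩).ne'

lemma integral_mul_div_speed_sq_pi_div_two {a b : ℝ} (ha : 0 < a) (hb : 0 < b) :
    ∫ x in 0..(π / 2), a * b / speed a b x ^ 2 = π / 2 := by
  have hc := continuous_speed a b
  have h := intervalIntegral.integral_eq_sub_of_hasDerivAt_of_tendsto (a := 0) (b := π / 2)
    (fa := 0) (fb := π / 2) (f := fun x => arctan (a / b * tan x)) pi_div_two_pos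
    (fun x hx => hasDerivAt_arctan_mul_tan ha.ne' hb.ne' (cos_pos_of_mem_quadrant hx).ne')
    ((continuous_const.div (hc.pow 2)
      fun x => pow_ne_zero 2 (speed_pos ha.ne' hb.ne' x).ne').intervalIntegrable _ _) ?_ ?_
  · rw [h, sub_zero]
  · have := (hasDerivAt_arctan_mul_tan ha.ne' hb.ne' (x := 0) (by simp)).continuousAt.tendsto
    simp only [tan_zero, mul_zero, arctan_zero] at this
    exact this.mono_left nhdsWithin_le_nhds
  · exact (tendsto_nhds_of_tendsto_nhdsWithin tendsto_arctan_atTop).comp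
      (tendsto_tan_pi_div_two.const_mul_atTop (div_pos ha hb))

lemma integral_speed_sq (a b φ : ℝ) :
    ∫ x in 0..φ, speed a b x ^ 2 =
      b ^ 2 * φ + (a ^ 2 - b ^ 2) * (φ - sin φ * cos φ) / 2 := by
  have h : ∀ x, speed a b x ^ 2 = b ^ 2 + (a ^ 2 - b ^ 2) * sin x ^ 2 := fun x => by
    rw [speed_sq, cos_sq']
    ring
  simp only [h]
  rw [intervalIntegral.integral_add (by simp) (Continuous.intervalIntegrable (by fun_prop) _ _),
    intervalIntegral.integral_const, intervalIntegral.integral_const_mul, integral_sin_sq]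
  simp
  ring

lemma hasDerivAt_Einc (ε φ : ℝ) : HasDerivAt (Einc ε) (√(1 - ε ^ 2 * sin φ ^ 2)) φ := by
  have hc : Continuous fun θ => √(1 - ε ^ 2 * sin θ ^ 2) := by fun_prop
  exact hc.integral_hasStrictDerivAt 0 φ |>.hasDerivAt

lemma ecc_sq {a b : ℝ} (hb : 0 < b) (hba : b < a) : ecc a b ^ 2 = (a ^ 2 - b ^ 2) / a ^ 2 := by
  rw [ecc, div_pow, sq_sqrt (sub_nonneg.2 (pow_le_pow_left₀ hb.le hba.le 2))]

section Elliptic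

variable {a b x : ℝ} (hb : 0 < b) (hba : b < a) (hx : 0 < cos x)

include hb hba hx

lemma cos_arctan_mul_tan : cos (arctan (a / b * tan x)) = b * cos x / speed a b x := by
  have ha := hb.trans hba
  have h : 1 + (a / b * tan x) ^ 2 = (speed a b x / (b * cos x)) ^ 2 := by
    rw [div_pow, speed_sq, tan_eq_sin_div_cos]
    field_simp
    ring
  rw [cos_arctan, h, sqrt_sq (div_pos (speed_pos ha.ne' hb.ne' x) (mul_pos hb hx)).le,
    one_div_div]

lemma sin_arctan_mul_tan : sin (arctan (a / b * tan x)) = a * sin x / speed a b x := by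
  have h := tan_mul_cos (cos_arctan_pos (a / b * tan x)).ne'
  rw [← h, tan_arctan, cos_arctan_mul_tan hb hba hx, tan_eq_sin_div_cos]
  field_simp

lemma sqrt_one_sub_ecc_sq :
    √(1 - ecc a b ^ 2 * sin (arctan (a / b * tan x)) ^ 2) = b / speed a b x := by
  have ha := hb.trans hba
  have hw := speed_pos ha.ne' hb.ne' x
  have h : 1 - ecc a b ^ 2 * sin (arctan (a / b * tan x)) ^ 2 = (b / speed a b x) ^ 2 := by
    rw [sin_arctan_mul_tan hb hba hx, ecc_sq hb hba]
    field_simp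
    rw [speed_sq, cos_sq']
    ring
  rw [h, sqrt_sq (div_pos hb hw).le]

omit hx in
lemma integral_speed {φ : ℝ} (hφ : φ ∈ Ico 0 (π / 2)) :
    ∫ x in 0..φ, speed a b x = a * Einc (ecc a b) (arctan (a / b * tan φ)) -
      (a ^ 2 - b ^ 2) * (sin φ * cos φ) / speed a b φ := by
  have ha := hb.trans hba
  have hd : ∀ x ∈ uIcc 0 φ, HasDerivAt (fun x => a * Einc (ecc a b) (arctan (a / b * tan x)) -
      (a ^ 2 - b ^ 2) * (sin x * (cos x / speed a b x))) (speed a b x) x := by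
    intro x hx
    rw [uIcc_of_le hφ.1] at hx
    have hcos : 0 < cos x :=
      cos_pos_of_mem_Ioo ⟨by linarith [hx.1, pi_pos], hx.2.trans_lt hφ.2⟩
    have hw := (speed_pos ha.ne' hb.ne' x).ne'
    convert! (((hasDerivAt_Einc (ecc a b) _).comp x
      (hasDerivAt_arctan_mul_tan ha.ne' hb.ne' hcos.ne')).const_mul a).sub
      (((hasDerivAt_sin x).mul (hasDerivAt_cos_div_speed ha.ne' hb.ne' x)).const_mul
        (a ^ 2 - b ^ 2)) using 1
    rw [sqrt_one_sub_ecc_sq hb hba hcos]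
    field_simp
    rw [show speed a b x ^ 4 = (speed a b x ^ 2) ^ 2 by ring, speed_sq, cos_sq']
    ring
  rw [intervalIntegral.integral_eq_sub_of_hasDerivAt hd
    ((continuous_speed a b).intervalIntegrable _ _)]
  simp [Einc, mul_div_assoc]

end Elliptic

/-- The parameter `x` of the first quadrant with `a * speed a b x / b = r`. -/
def switchAngle (a b r : ℝ) : ℝ := arctan (b * √(r ^ 2 - a ^ 2) / √(a ^ 4 - r ^ 2 * b ^ 2))

lemma speed_le_speed {a b x y : ℝ} (hb : 0 < b) (hba : b < a) (hx : 0 ≤ x) (hxy : x ≤ y)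
    (hy : y ≤ π / 2) : speed a b x ≤ speed a b y := by
  refine sqrt_le_sqrt ?_
  have h := pow_le_pow_left₀ (sin_nonneg_of_nonneg_of_le_pi hx (by linarith [pi_pos]))
    (sin_le_sin_of_le_of_le_pi_div_two (by linarith) hy hxy) 2
  have h3 : 0 < a ^ 2 - b ^ 2 := sub_pos.2 (pow_lt_pow_left₀ hba hb.le two_ne_zero)
  rw [cos_sq', cos_sq']
  nlinarith

section Switch

variable {a b r : ℝ} (hb : 0 < b) (hba : b < a) (hr1 : a < r) (hr2 : r < a ^ 2 / b)

lemma arctan_mul_tan_switchAngle (hb : b ≠ 0) :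
    arctan (a / b * tan (switchAngle a b r)) = betaAng a b r := by
  rw [switchAngle, tan_arctan, betaAng]
  congr 1
  field_simp

lemma arctan_mul_tan_betaAng (ha : a ≠ 0) :
    arctan (b / a * tan (betaAng a b r)) = switchAngle a b r := by
  rw [switchAngle, betaAng, tan_arctan]
  congr 1
  field_simp

lemma continuous_stripArea_min_sub (ha : a ≠ 0) (hb : b ≠ 0) :
    Continuous fun x =>
      stripArea a (-b) x (min r (a * speed a b x / b)) - stripArea a (-b) x r := by
  have hc := continuous_speed a b
  exact (continuous_stripArea ha (neg_ne_zero.2 hb) (by fun_prop)).sub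
    (continuous_stripArea ha (neg_ne_zero.2 hb) continuous_const)

lemma switchAngle_mem (hb : 0 ≤ b) : switchAngle a b r ∈ Ico 0 (π / 2) :=
  ⟨arctan_nonneg.2 (by positivity), arctan_lt_pi_div_two _⟩

include hb hba hr1 hr2

lemma speed_switchAngle : speed a b (switchAngle a b r) = r * b / a := by
  have ha := hb.trans hba
  have hrb : r * b < a ^ 2 := (lt_div_iff₀ hb).1 hr2
  have hr0 := ha.trans hr1
  have h1 : 0 < r ^ 2 - a ^ 2 := sub_pos.2 (pow_lt_pow_left₀ hr1 ha.le two_ne_zero)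
  have h2 : 0 < a ^ 4 - r ^ 2 * b ^ 2 := by
    have := pow_lt_pow_left₀ hrb (by positivity) two_ne_zero
    linarith
  have h3 : 0 < a ^ 2 - b ^ 2 := sub_pos.2 (pow_lt_pow_left₀ hba hb.le two_ne_zero)
  rw [speed, ← sqrt_sq (show 0 ≤ r * b / a by positivity)]
  congr 1
  rw [switchAngle, sin_sq_arctan, cos_sq_arctan, div_pow, mul_pow, sq_sqrt h1.le, sq_sqrt h2.le,
    show 1 + b ^ 2 * (r ^ 2 - a ^ 2) / (a ^ 4 - r ^ 2 * b ^ 2) =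
      a ^ 2 * (a ^ 2 - b ^ 2) / (a ^ 4 - r ^ 2 * b ^ 2) by rw [one_add_div h2.ne']; ring,
    div_div_div_cancel_right₀ h2.ne', one_div_div]
  field_simp
  ring

lemma integral_stripArea_min :
    ∫ x in 0..(π / 2), (stripArea a (-b) x (min r (a * speed a b x / b)) - stripArea a (-b) x r) =
      ∫ x in 0..switchAngle a b r, (a / b * speed a b x ^ 2 - a ^ 3 / (2 * b) -
        r * speed a b x + r ^ 2 / 2 * (a * b / speed a b x ^ 2)) := by
  have ha := hb.trans hba
  have hc := continuous_speed a b
  obtain ⟨h0, h1⟩ := switchAngle_mem (a := a) (r := r) hb.le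
  have hs := speed_switchAngle hb hba hr1 hr2
  have hsr : a * speed a b (switchAngle a b r) / b = r := by rw [hs]; field_simp
  have hcont := continuous_stripArea_min_sub (r := r) ha.ne' hb.ne'
  rw [← intervalIntegral.integral_add_adjacent_intervals
    (hcont.intervalIntegrable 0 (switchAngle a b r)) (hcont.intervalIntegrable _ _)]
  have h2 : ∫ x in switchAngle a b r..(π / 2), (stripArea a (-b) x
      (min r (a * speed a b x / b)) - stripArea a (-b) x r) = 0 := by
    refine intervalIntegral.integral_zero_ae (ae_of_all _ fun x hx => ?_)
    rw [uIoc_of_le h1.le] at hx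
    have := speed_le_speed hb hba h0 hx.1.le hx.2
    rw [min_eq_left, sub_self]
    rw [← hsr]
    gcongr
  rw [h2, add_zero]
  refine intervalIntegral.integral_congr fun x hx => ?_
  rw [uIcc_of_le h0] at hx
  have hw := speed_pos ha.ne' hb.ne' x
  have := speed_le_speed hb hba hx.1 hx.2 h1.le
  have hle : a * speed a b x / b ≤ r := by
    rw [← hsr]
    gcongr
  simp only [min_eq_right hle, stripArea, speed_neg_right]
  field_simp
  ring

lemma four_mul_integral_eq_Ffun :
    4 * ∫ x in 0..switchAngle a b r, (a / b * speed a b x ^ 2 - a ^ 3 / (2 * b) -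
        r * speed a b x + r ^ 2 / 2 * (a * b / speed a b x ^ 2)) = Ffun a b r (betaAng a b r) := by
  have ha := hb.trans hba
  have hr0 := ha.trans hr1
  have hc := continuous_speed a b
  have hw0 : ∀ x, speed a b x ^ 2 ≠ 0 := fun x => pow_ne_zero 2 (speed_pos ha.ne' hb.ne' x).ne'
  have hφ := switchAngle_mem (a := a) (r := r) hb.le
  have hcos : 0 < cos (switchAngle a b r) := cos_arctan_pos _
  have hi : ∀ {f : ℝ → ℝ}, Continuous f → IntervalIntegrable f volume 0 (switchAngle a b r) :=
    fun hf => hf.intervalIntegrable _ _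
  rw [intervalIntegral.integral_add (hi (by fun_prop)) (hi (by fun_prop (disch := exact hw0 _))),
    intervalIntegral.integral_sub (hi (by fun_prop)) (hi (by fun_prop)),
    intervalIntegral.integral_sub (hi (by fun_prop)) (hi (by fun_prop)),
    intervalIntegral.integral_const_mul, intervalIntegral.integral_const_mul,
    intervalIntegral.integral_const_mul, intervalIntegral.integral_const, integral_speed_sq,
    integral_speed hb hba hφ, integral_mul_div_speed_sq ha.ne' hb.ne' hφ, Ffun,
    arctan_mul_tan_betaAng ha.ne', ← arctan_mul_tan_switchAngle hb.ne', sin_two_mul,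
    sqrt_one_sub_ecc_sq hb hba hcos, sin_arctan_mul_tan hb hba hcos,
    cos_arctan_mul_tan hb hba hcos, speed_switchAngle hb hba hr1 hr2, ecc_sq hb hba]
  simp only [smul_eq_mul, sub_zero]
  field_simp
  ring

lemma four_mul_integral_quarterIntegrand :
    4 * ∫ x in 0..(π / 2), quarterIntegrand a b r x =
      2 * π * r ^ 2 + 2 * π * a * b - 2 * Ffun a b r (betaAng a b r) := by
  have ha := hb.trans hba
  have hc := continuous_speed a b
  have hw0 : ∀ x, speed a b x ^ 2 ≠ 0 := fun x => pow_ne_zero 2 (speed_pos ha.ne' hb.ne' x).ne'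
  have hi : ∀ {f : ℝ → ℝ}, Continuous f → IntervalIntegrable f volume 0 (π / 2) :=
    fun hf => hf.intervalIntegrable _ _
  have hquarter : ∀ x, quarterIntegrand a b r x =
      r ^ 2 * (a * b / speed a b x ^ 2) + 2 * b / a * speed a b x ^ 2 - b ^ 3 / a -
        2 * (stripArea a (-b) x (min r (a * speed a b x / b)) - stripArea a (-b) x r) := fun x => by
    have hw := speed_pos ha.ne' hb.ne' x
    simp only [quarterIntegrand]
    generalize stripArea a (-b) x (min r (a * speed a b x / b)) = s
    simp only [stripArea, speed_neg_right]
    field_simp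
    ring
  simp only [hquarter]
  rw [← four_mul_integral_eq_Ffun hb hba hr1 hr2, ← integral_stripArea_min hb hba hr1 hr2,
    intervalIntegral.integral_sub (hi (by fun_prop (disch := exact hw0 _)))
      ((hi (continuous_stripArea_min_sub ha.ne' hb.ne')).const_mul 2),
    intervalIntegral.integral_sub (hi (by fun_prop (disch := exact hw0 _))) (hi (by fun_prop)),
    intervalIntegral.integral_add (hi (by fun_prop (disch := exact hw0 _))) (hi (by fun_prop)),
    intervalIntegral.integral_const_mul, intervalIntegral.integral_const_mul,
    intervalIntegral.integral_const_mul, intervalIntegral.integral_const,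
    integral_mul_div_speed_sq_pi_div_two ha hb, integral_speed_sq]
  simp only [smul_eq_mul, sub_zero, sin_pi_div_two, cos_pi_div_two]
  field_simp
  ring

end Switch

/-- Case 4 of Lemma 1: for `a < r < a²/b`, the area of the set of centers `x` for which the
circle of radius `r` about `x` meets the ellipse in exactly two points is
`2πr² + 2πab − 2F(β)`. -/
theorem area_two_intersections_case4 (a b r : ℝ) (hb : 0 < b) (hba : b < a)
    (hr1 : a < r) (hr2 : r < a^2 / b) :
    volume {x : E2 | (sphere x r ∩ Cset a b).ncard = 2} =
      ENNReal.ofReal (2*π*r^2 + 2*π*a*b - 2 * Ffun a b r (betaAng a b r)) := by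
  rw [volume_setOf_ncard_eq, volume_twoPointCenters ((hb.trans hba).trans hr1).le,
    volume_twoPointCenters_inter_quadrant hb hba hr1,
    ← four_mul_integral_quarterIntegrand hb hba hr1 hr2, ENNReal.ofReal_mul (by norm_num)]
  norm_num
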